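/- Let (G, dist) be an infinite finitely generated group endowed with a word metric, asymptotically tree-graded with respect to a collection 𝓐 of subsets of G, with G not contained in any finite-radius tubular neighborhood of a member of 𝓐. Let ϰ be the maximum of the constant M in property (β2) and the constant χ in property (β3) of (G,𝓐) (these properties hold since G is ATG). Then G is either hyperbolic, or hyperbolic relative to a family of proper finitely generated subgroups {H₁, …, H_m} such that each H_i is contained in N_ϰ(A_i) for some A_i ∈ 𝓐. -/

import Mathlib

open Set Metric

/-! ### Basic metric notions: tubular neighborhoods, geodesics -/

variable {X : Type*} [MetricSpace X]

/-- Open `δ`-tubular neighborhood of a subset. -/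
def tubN (δ : ℝ) (A : Set X) : Set X := {x | Metric.infDist x A < δ}

/-- Closed `δ`-tubular neighborhood of a subset. -/
def ctubN (δ : ℝ) (A : Set X) : Set X := {x | Metric.infDist x A ≤ δ}

/-- `γ` parametrizes a geodesic of length `ℓ` (an isometric embedding of `[0,ℓ]`). -/
def IsGeodesicParam (γ : ℝ → X) (ℓ : ℝ) : Prop :=
  0 ≤ ℓ ∧ ∀ s ∈ Set.Icc (0:ℝ) ℓ, ∀ t ∈ Set.Icc (0:ℝ) ℓ, dist (γ s) (γ t) = |s - t|

/-- A metric space is geodesic if every two points are joined by a geodesic. -/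
def GeodesicSpace (X : Type*) [MetricSpace X] : Prop :=
  ∀ x y : X, ∃ (γ : ℝ → X) (ℓ : ℝ), IsGeodesicParam γ ℓ ∧ γ 0 = x ∧ γ ℓ = y

/-- The cyclic successor of an index in `Fin k`. -/
def finCycSucc {k : ℕ} (i : Fin k) : Fin k := ⟨(i.val + 1) % k, Nat.mod_lt _ i.pos⟩

/-! ### Polygons -/

/-- The data of a `k`-gon: `k` parametrized paths with their lengths. -/
structure PrePolygon (X : Type*) (k : ℕ) where
  edge : Fin k → ℝ → X
  len : Fin k → ℝ

namespace PrePolygon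

variable {k : ℕ}

/-- The `i`-th edge, as a subset. -/
def edgeSet (P : PrePolygon X k) (i : Fin k) : Set X := P.edge i '' Set.Icc 0 (P.len i)

/-- The polygon, as a subset (union of its edges). -/
def carrier (P : PrePolygon X k) : Set X := ⋃ i, P.edgeSet i

/-- The `i`-th vertex (the origin of the `i`-th edge). -/
def vertex (P : PrePolygon X k) (i : Fin k) : X := P.edge i 0

/-- The union `O_x` of the edges not adjacent to the `i`-th vertex. -/
def opp (P : PrePolygon X k) (i : Fin k) : Set X :=
  ⋃ j ∈ {j : Fin k | j ≠ i ∧ finCycSucc j ≠ i}, P.edgeSet j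

/-- The edges close up cyclically (the endpoint of each edge is the origin of the next). -/
def IsClosedPolygon (P : PrePolygon X k) : Prop :=
  (∀ i, 0 ≤ P.len i) ∧ ∀ i, P.edge i (P.len i) = P.edge (finCycSucc i) 0

/-- A geodesic `k`-gon. -/
def IsGeodesicPolygon (P : PrePolygon X k) : Prop :=
  P.IsClosedPolygon ∧ ∀ i, IsGeodesicParam (P.edge i) (P.len i)

/-- The polygon is `(θ,σ,ν)`-fat:  (F1) every point of an edge at distance at least `σθ`
from both endpoints of the edge is at distance at least `θ` from the rest of the polygon;
(F2) every vertex is at distance at least `νθ` from the union of the non-adjacent edges. -/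
def IsFat (P : PrePolygon X k) (θ σ ν : ℝ) : Prop :=
  (∀ i : Fin k, ∀ p ∈ P.edgeSet i,
      σ * θ ≤ dist p (P.edge i 0) → σ * θ ≤ dist p (P.edge i (P.len i)) →
      θ ≤ Metric.infDist p (P.carrier \ P.edgeSet i)) ∧
  (∀ i : Fin k, ν * θ ≤ Metric.infDist (P.vertex i) (P.opp i))

/-- `(θ,ν)`-fat means `(θ,2,ν)`-fat. -/
def IsFat2 (P : PrePolygon X k) (θ ν : ℝ) : Prop := P.IsFat θ 2 ν

end PrePolygon

/-! ### Gromov hyperbolicity (thin triangles) -/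

/-- A geodesic metric space is Gromov hyperbolic if there is `δ ≥ 0` such that every geodesic
triangle is `δ`-thin: each side lies in the closed `δ`-neighborhood of the other two sides. -/
def GromovHyperbolic (X : Type*) [MetricSpace X] : Prop :=
  ∃ δ : ℝ, 0 ≤ δ ∧ ∀ T : PrePolygon X 3, T.IsGeodesicPolygon →
    ∀ i : Fin 3, ∀ p ∈ T.edgeSet i,
      Metric.infDist p (T.edgeSet (finCycSucc i) ∪ T.edgeSet (finCycSucc (finCycSucc i))) ≤ δ

/-! ### The Druţu–Sapir properties of a pair `(X, 𝓐)` -/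

/-- Property (α₁): uniformly bounded intersections of tubular neighborhoods. -/
def Alpha1 (𝓐 : Set (Set X)) : Prop :=
  ∀ δ : ℝ, 0 < δ → ∃ D : ℝ, ∀ A ∈ 𝓐, ∀ A' ∈ 𝓐, A ≠ A' →
    ∀ x ∈ tubN δ A ∩ tubN δ A', ∀ y ∈ tubN δ A ∩ tubN δ A', dist x y ≤ D

/-- Property (α₂) with given constants `ε`, `M`. -/
def Alpha2With (𝓐 : Set (Set X)) (ε M : ℝ) : Prop :=
  ∀ (γ : ℝ → X) (ℓ : ℝ), IsGeodesicParam γ ℓ → ∀ A ∈ 𝓐,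
    γ 0 ∈ tubN (ε * ℓ) A → γ ℓ ∈ tubN (ε * ℓ) A →
    ∃ t ∈ Set.Icc (0:ℝ) ℓ, γ t ∈ tubN M A

/-- Property (α₂). -/
def Alpha2 (𝓐 : Set (Set X)) : Prop :=
  ∃ ε M : ℝ, 0 ≤ ε ∧ ε < 1/2 ∧ 0 < M ∧ Alpha2With 𝓐 ε M

/-- Property (α₃): fat geodesic `k`-gons lie in tubular neighborhoods of pieces. -/
def Alpha3 (𝓐 : Set (Set X)) : Prop :=
  ∀ k : ℕ, 2 ≤ k → ∃ θ : ℝ, 0 < θ ∧ ∃ ν : ℝ, 8 ≤ ν ∧ ∃ χ : ℝ, 0 < χ ∧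
    ∀ P : PrePolygon X k, P.IsGeodesicPolygon → P.IsFat2 θ ν →
      ∃ A ∈ 𝓐, P.carrier ⊆ tubN χ A

/-- Property (β₂) with given constants `ε`, `M`: middle thirds of geodesics with endpoints
close to a piece stay close to the piece. -/
def Beta2With (𝓐 : Set (Set X)) (ε M : ℝ) : Prop :=
  ∀ (γ : ℝ → X) (ℓ : ℝ), IsGeodesicParam γ ℓ → ∀ A ∈ 𝓐,
    γ 0 ∈ tubN (ε * ℓ) A → γ ℓ ∈ tubN (ε * ℓ) A →
    ∀ t ∈ Set.Icc (ℓ/3) (2*ℓ/3), γ t ∈ tubN M A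

/-- Property (β₂). -/
def Beta2 (𝓐 : Set (Set X)) : Prop := ∃ ε M : ℝ, 0 < ε ∧ 0 ≤ M ∧ Beta2With 𝓐 ε M

/-- Property (β₃) with given constants: fat geodesic hexagons lie in tubular
neighborhoods of pieces. -/
def Beta3With (𝓐 : Set (Set X)) (θ ν χ : ℝ) : Prop :=
  ∀ P : PrePolygon X 6, P.IsGeodesicPolygon → P.IsFat2 θ ν → ∃ A ∈ 𝓐, P.carrier ⊆ tubN χ A

/-- Property (β₃). -/
def Beta3 (𝓐 : Set (Set X)) : Prop :=
  ∃ θ : ℝ, 0 < θ ∧ ∃ ν : ℝ, 8 ≤ ν ∧ ∃ χ : ℝ, 0 < χ ∧ Beta3With 𝓐 θ ν χ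

/-- Property (Q), uniform quasi-convexity of pieces, with given constants `t`, `K₀`. -/
def PropQWith (𝓐 : Set (Set X)) (t K₀ : ℝ) : Prop :=
  ∀ A ∈ 𝓐, ∀ K : ℝ, K₀ ≤ K → ∀ (γ : ℝ → X) (ℓ : ℝ), IsGeodesicParam γ ℓ →
    γ 0 ∈ tubN K A → γ ℓ ∈ tubN K A → ∀ s ∈ Set.Icc (0:ℝ) ℓ, γ s ∈ tubN (t * K) A

/-- Property (Q), uniform quasi-convexity of pieces. -/
def PropQ (𝓐 : Set (Set X)) : Prop :=
  ∃ t : ℝ, 0 < t ∧ ∃ K₀ : ℝ, 0 ≤ K₀ ∧ PropQWith 𝓐 t K₀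

/-- `X` is asymptotically tree-graded with respect to `𝓐` (Druţu–Sapir metric
characterization, taken as the definition): (α₁), (α₂) and (α₃) hold. -/
def ATG (𝓐 : Set (Set X)) : Prop := Alpha1 𝓐 ∧ Alpha2 𝓐 ∧ Alpha3 𝓐

/-! ### Entrance and exit points, almost geodesics, the (*) property -/

/-- The entrance point of the path `p : [0,ℓ] → X` in the set `S`. -/
noncomputable def entrancePoint (p : ℝ → X) (ℓ : ℝ) (S : Set X) : X :=
  p (sInf {t | t ∈ Set.Icc (0:ℝ) ℓ ∧ p t ∈ S})

/-- The exit point of the path `p : [0,ℓ] → X` from the set `S`. -/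
noncomputable def exitPoint (p : ℝ → X) (ℓ : ℝ) (S : Set X) : X :=
  p (sSup {t | t ∈ Set.Icc (0:ℝ) ℓ ∧ p t ∈ S})

/-- `q` is a `(1,C)`-almost geodesic on `[0,ℓ]`: a `1`-Lipschitz `(1,C)`-quasi-geodesic. -/
def IsAlmostGeodesic (C : ℝ) (q : ℝ → X) (ℓ : ℝ) : Prop :=
  0 ≤ ℓ ∧ ∀ s ∈ Set.Icc (0:ℝ) ℓ, ∀ t ∈ Set.Icc (0:ℝ) ℓ,
    |s - t| - C ≤ dist (q s) (q t) ∧ dist (q s) (q t) ≤ |s - t|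

/-- The `(*)` alternative for triangles with `(1,C)`-almost geodesic edges,
with constants `σ`, `δ`. -/
def StarATGWith (𝓐 : Set (Set X)) (C σ δ : ℝ) : Prop :=
  ∀ T : PrePolygon X 3, T.IsClosedPolygon →
    (∀ i, IsAlmostGeodesic C (T.edge i) (T.len i)) →
    (∃ a : X, ∀ i : Fin 3, (Metric.closedBall a σ ∩ T.edgeSet i).Nonempty) ∨
    (∃ A ∈ 𝓐, (∀ i : Fin 3, (ctubN σ A ∩ T.edgeSet i).Nonempty) ∧
      ∀ i : Fin 3, dist (exitPoint (T.edge i) (T.len i) (ctubN σ A))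
        (entrancePoint (T.edge (finCycSucc i)) (T.len (finCycSucc i)) (ctubN σ A)) < δ)

/-- `X` is `(*)`-asymptotically tree-graded with respect to `𝓐`. -/
def StarATG (𝓐 : Set (Set X)) : Prop :=
  ∀ C : ℝ, 0 ≤ C → ∃ σ δ : ℝ, StarATGWith 𝓐 C σ δ

/-- The word norm of `g` with respect to the generating set `S`: the least length of a
word in `S ∪ S⁻¹` representing `g`. -/
noncomputable def wordNorm {G : Type*} [Group G] (S : Set G) (g : G) : ℕ :=
  sInf {n : ℕ | ∃ l : List G, l.length = n ∧ (∀ x ∈ l, x ∈ S ∨ x⁻¹ ∈ S) ∧ l.prod = g}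

/-- The word metric on `G` associated with the generating set `S`. -/
noncomputable def wdist {G : Type*} [Group G] (S : Set G) (a b : G) : ℝ :=
  (wordNorm S (a⁻¹ * b) : ℝ)

/-- The orbit map `g ↦ g • x₀`, identifying group elements with the vertices of the
Cayley graph. -/
def orbitMap {G : Type*} [Group G] {X : Type*} [MulAction G X] (x₀ : X) : G → X :=
  fun g => g • x₀

/-- `X` (with basepoint `x₀` and the given `G`-action) is a geometric model of the
Cayley graph of `G` with respect to the finite generating set `S`: `X` is geodesic,
`G` acts by isometries, the orbit of `x₀` realizes the word metric of `(G,S)`, and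
every point of `X` is within distance `1/2` of the orbit. -/
def IsCayleyModel (G : Type*) [Group G] (S : Set G) (X : Type*) [MetricSpace X]
    [MulAction G X] (x₀ : X) : Prop :=
  S.Finite ∧ Subgroup.closure S = ⊤ ∧ GeodesicSpace X ∧
  (∀ g : G, Isometry (fun x : X => g • x)) ∧
  (∀ g h : G, dist (g • x₀) (h • x₀) = wdist S g h) ∧
  (∀ x : X, ∃ g : G, dist x (g • x₀) ≤ 1/2)

/-- The family of subsets of the Cayley graph corresponding to a family `𝓑` of subsets
of the group. -/
def imageFam {G X : Type*} [Group G] [MulAction G X] (x₀ : X) (𝓑 : Set (Set G)) :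
    Set (Set X) :=
  {Y | ∃ B ∈ 𝓑, Y = orbitMap x₀ '' B}

/-- The family of subsets of the Cayley graph corresponding to all left cosets of the
subgroups `H i`. -/
def cosetFam {G X : Type*} [Group G] [MulAction G X] (x₀ : X) {m : ℕ}
    (H : Fin m → Subgroup G) : Set (Set X) :=
  {Y | ∃ (i : Fin m) (g : G), Y = orbitMap x₀ '' ((g * ·) '' (H i : Set G))}

/-! ### Geodesic segments as sets -/

section Segments

/-- `s` is (the image of) a geodesic segment from `x` to `y`. -/
def IsSeg (s : Set X) (x y : X) : Prop :=
  ∃ (γ : ℝ → X) (ℓ : ℝ), IsGeodesicParam γ ℓ ∧ γ 0 = x ∧ γ ℓ = y ∧ s = γ '' Set.Icc 0 ℓ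

theorem IsGeodesicParam.continuousOn {γ : ℝ → X} {ℓ : ℝ} (h : IsGeodesicParam γ ℓ) :
    ContinuousOn γ (Set.Icc 0 ℓ) := by
  have : LipschitzOnWith 1 γ (Set.Icc 0 ℓ) := by
    apply LipschitzOnWith.of_dist_le_mul
    intro a ha b hb
    rw [h.2 a ha b hb, Real.dist_eq]; simp
  exact this.continuousOn

theorem IsGeodesicParam.sub {γ : ℝ → X} {ℓ : ℝ} (h : IsGeodesicParam γ ℓ) {a b : ℝ}
    (ha : 0 ≤ a) (hab : a ≤ b) (hb : b ≤ ℓ) :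
    IsGeodesicParam (fun t => γ (a + t)) (b - a) := by
  refine ⟨by linarith, fun s hs t ht => ?_⟩
  rw [h.2 _ ⟨by linarith [hs.1], by linarith [hs.2]⟩ _ ⟨by linarith [ht.1], by linarith [ht.2]⟩]
  congr 1; ring

theorem isSeg_image {γ : ℝ → X} {ℓ : ℝ} (h : IsGeodesicParam γ ℓ) {a b : ℝ}
    (ha : 0 ≤ a) (hab : a ≤ b) (hb : b ≤ ℓ) : IsSeg (γ '' Set.Icc a b) (γ a) (γ b) := by
  refine ⟨_, _, h.sub ha hab hb, by simp, by simp, ?_⟩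
  ext x
  constructor
  · rintro ⟨t, ht, rfl⟩
    exact ⟨t - a, ⟨by linarith [ht.1], by linarith [ht.2]⟩, by simp⟩
  · rintro ⟨t, ht, rfl⟩
    exact ⟨a + t, ⟨by linarith [ht.1], by linarith [ht.2]⟩, rfl⟩

theorem IsSeg.symm {s : Set X} {x y : X} (h : IsSeg s x y) : IsSeg s y x := by
  obtain ⟨γ, ℓ, hg, rfl, rfl, rfl⟩ := h
  refine ⟨fun t => γ (ℓ - t), ℓ, ⟨hg.1, fun s hs t ht => ?_⟩, by simp, by simp, ?_⟩
  · rw [hg.2 _ ⟨by linarith [hs.2], by linarith [hs.1]⟩ _ ⟨by linarith [ht.2], by linarith [ht.1]⟩,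
      abs_sub_comm]
    congr 1; ring
  · ext x
    constructor
    · rintro ⟨t, ht, rfl⟩
      exact ⟨ℓ - t, ⟨by linarith [ht.2], by linarith [ht.1]⟩, by simp⟩
    · rintro ⟨t, ht, rfl⟩
      exact ⟨ℓ - t, ⟨by linarith [ht.2], by linarith [ht.1]⟩, rfl⟩

theorem IsSeg.left_mem {s : Set X} {x y : X} (h : IsSeg s x y) : x ∈ s := by
  obtain ⟨γ, ℓ, hg, rfl, rfl, rfl⟩ := h
  exact ⟨0, ⟨le_rfl, hg.1⟩, rfl⟩

theorem IsSeg.right_mem {s : Set X} {x y : X} (h : IsSeg s x y) : y ∈ s := h.symm.left_mem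

theorem IsSeg.add {s : Set X} {x y p : X} (h : IsSeg s x y) (hp : p ∈ s) :
    dist x p + dist p y = dist x y := by
  obtain ⟨γ, ℓ, hg, rfl, rfl, rfl⟩ := h
  obtain ⟨t, ht, rfl⟩ := hp
  have h0 : (0:ℝ) ∈ Set.Icc 0 ℓ := ⟨le_rfl, hg.1⟩
  have h1 : ℓ ∈ Set.Icc 0 ℓ := ⟨hg.1, le_rfl⟩
  rw [hg.2 _ h0 _ ht, hg.2 _ ht _ h1, hg.2 _ h0 _ h1, abs_of_nonpos (by linarith [ht.1]),
    abs_of_nonpos (by linarith [ht.2]), abs_of_nonpos (by linarith [hg.1])]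
  ring

theorem IsSeg.isCompact {s : Set X} {x y : X} (h : IsSeg s x y) : IsCompact s := by
  obtain ⟨γ, ℓ, hg, rfl, rfl, rfl⟩ := h
  exact isCompact_Icc.image_of_continuousOn hg.continuousOn

theorem IsSeg.sub {s : Set X} {x y p q : X} (h : IsSeg s x y) (hp : p ∈ s) (hq : q ∈ s) :
    ∃ s' ⊆ s, IsSeg s' p q := by
  obtain ⟨γ, ℓ, hg, rfl, rfl, rfl⟩ := h
  obtain ⟨t, ht, rfl⟩ := hp
  obtain ⟨u, hu, rfl⟩ := hq
  rcases le_total t u with htu | htu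
  · exact ⟨_, Set.image_mono (Set.Icc_subset_Icc ht.1 hu.2), isSeg_image hg ht.1 htu hu.2⟩
  · exact ⟨_, Set.image_mono (Set.Icc_subset_Icc hu.1 ht.2), (isSeg_image hg hu.1 htu ht.2).symm⟩

theorem GeodesicSpace.seg (hX : GeodesicSpace X) (x y : X) : ∃ s, IsSeg s x y := by
  obtain ⟨γ, ℓ, h, h0, h1⟩ := hX x y
  exact ⟨_, γ, ℓ, h, h0, h1, rfl⟩

theorem last_cut {f : ℝ → ℝ} {a b c : ℝ} (hab : a ≤ b) (hf : ContinuousOn f (Set.Icc a b))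
    (ha : f a ≤ c) (hb : c ≤ f b) :
    ∃ t ∈ Set.Icc a b, f t = c ∧ ∀ u ∈ Set.Icc t b, c ≤ f u := by
  have hne : ({t | t ∈ Set.Icc a b ∧ f t ≤ c}).Nonempty := ⟨a, ⟨le_rfl, hab⟩, ha⟩
  have hcl : IsCompact ({t | t ∈ Set.Icc a b ∧ f t ≤ c}) := by
    have : {t | t ∈ Set.Icc a b ∧ f t ≤ c} = Set.Icc a b ∩ f ⁻¹' (Set.Iic c) := rfl
    rw [this]
    exact isCompact_Icc.of_isClosed_subset
      (hf.preimage_isClosed_of_isClosed isClosed_Icc isClosed_Iic) Set.inter_subset_left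
  obtain ⟨t, ⟨ht1, ht2⟩, hmax⟩ := hcl.exists_isGreatest hne
  have hsub : ContinuousOn f (Set.Icc t b) := hf.mono (Set.Icc_subset_Icc ht1.1 le_rfl)
  obtain ⟨u, hu, hfu⟩ := intermediate_value_Icc ht1.2 hsub ⟨ht2, hb⟩
  have hut : u ≤ t := hmax ⟨⟨ht1.1.trans hu.1, hu.2⟩, hfu.le⟩
  have : u = t := le_antisymm hut hu.1
  subst this
  refine ⟨u, ht1, hfu, fun w hw => ?_⟩
  by_contra hlt
  push Not at hlt
  have : w ≤ u := hmax ⟨⟨ht1.1.trans hw.1, hw.2⟩, hlt.le⟩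
  have : w = u := le_antisymm this hw.1
  rw [this, hfu] at hlt
  exact lt_irrefl _ hlt

theorem first_cut {f : ℝ → ℝ} {a b c : ℝ} (hab : a ≤ b) (hf : ContinuousOn f (Set.Icc a b))
    (ha : c ≤ f a) (hb : f b ≤ c) :
    ∃ t ∈ Set.Icc a b, f t = c ∧ ∀ u ∈ Set.Icc a t, c ≤ f u := by
  have hf' : ContinuousOn (fun t => f (-t)) (Set.Icc (-b) (-a)) := by
    apply hf.comp continuous_neg.continuousOn
    intro t ht
    exact ⟨by linarith [ht.2], by linarith [ht.1]⟩
  obtain ⟨t, ht, h1, h2⟩ := last_cut (c := c) (neg_le_neg hab) hf' (by simpa using hb)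
    (by simpa using ha)
  refine ⟨-t, ⟨by linarith [ht.2], by linarith [ht.1]⟩, h1, fun u hu => ?_⟩
  have := h2 (-u) ⟨by linarith [hu.2], by linarith [hu.1]⟩
  simpa using this

/-- One-sided cut of a segment by a level of a continuous function. -/
theorem IsSeg.cut1 {s : Set X} {p b : X} (h : IsSeg s p b) {g : X → ℝ} (hg : Continuous g) {c : ℝ}
    (hp : c ≤ g p) (hb : g b ≤ c) :
    ∃ y ∈ s, ∃ s' ⊆ s, IsSeg s' p y ∧ g y = c ∧ ∀ q ∈ s', c ≤ g q := by
  obtain ⟨γ, ℓ, hγ, rfl, rfl, rfl⟩ := h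
  obtain ⟨t, ht, h1, h2⟩ := first_cut (f := fun t => g (γ t)) hγ.1
    (hg.comp_continuousOn hγ.continuousOn) hp hb
  refine ⟨γ t, ⟨t, ht, rfl⟩, γ '' Set.Icc 0 t, Set.image_mono (Set.Icc_subset_Icc le_rfl ht.2),
    isSeg_image hγ le_rfl ht.1 ht.2, h1, ?_⟩
  rintro _ ⟨u, hu, rfl⟩
  exact h2 u hu

/-- Two-sided cut of a segment by a level of a continuous function. -/
theorem IsSeg.cut2 {s : Set X} {a b p : X} (h : IsSeg s a b) (hps : p ∈ s) {g : X → ℝ}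
    (hg : Continuous g) {c : ℝ} (ha : g a ≤ c) (hp : c ≤ g p) (hb : g b ≤ c) :
    ∃ x ∈ s, ∃ y ∈ s, ∃ s' ⊆ s, IsSeg s' x y ∧ p ∈ s' ∧ g x = c ∧ g y = c ∧ ∀ q ∈ s', c ≤ g q := by
  obtain ⟨γ, ℓ, hγ, rfl, rfl, rfl⟩ := h
  obtain ⟨t, ht, rfl⟩ := hps
  have hc : ContinuousOn (fun t => g (γ t)) (Set.Icc 0 ℓ) := hg.comp_continuousOn hγ.continuousOn
  obtain ⟨t1, ht1, h1, h1'⟩ := last_cut (f := fun t => g (γ t)) ht.1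
    (hc.mono (Set.Icc_subset_Icc le_rfl ht.2)) ha hp
  obtain ⟨t2, ht2, h2, h2'⟩ := first_cut (f := fun t => g (γ t)) ht.2
    (hc.mono (Set.Icc_subset_Icc ht.1 le_rfl)) hp hb
  refine ⟨γ t1, ⟨t1, ⟨ht1.1, ht1.2.trans ht.2⟩, rfl⟩, γ t2, ⟨t2, ⟨ht.1.trans ht2.1, ht2.2⟩, rfl⟩,
    γ '' Set.Icc t1 t2, Set.image_mono (Set.Icc_subset_Icc ht1.1 ht2.2),
    isSeg_image hγ ht1.1 (ht1.2.trans ht2.1) ht2.2, ⟨t, ⟨ht1.2, ht2.1⟩, rfl⟩, h1, h2, ?_⟩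
  rintro _ ⟨u, hu, rfl⟩
  rcases le_total u t with hut | hut
  · exact h1' u ⟨hu.1, hut⟩
  · exact h2' u ⟨hut, hu.2⟩

/-- If `u` is a nearest point to `u'` compared with `p`, distances from `p` to `[u,u']`. -/
theorem IsSeg.far {s : Set X} {u u' p q : X} (h : IsSeg s u u') (hq : q ∈ s)
    (hp : dist u u' ≤ dist p u') : dist q u ≤ dist p q ∧ dist p u ≤ 2 * dist p q := by
  have h1 := h.add hq
  have h2 := dist_triangle p q u'
  have h3 := dist_triangle p q u
  rw [dist_comm u q] at h1
  constructor <;> linarith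

/-- A polygon from a cyclic family of segments. -/
theorem exists_polygon {k : ℕ} (v : Fin k → X) (s : Fin k → Set X)
    (h : ∀ i, IsSeg (s i) (v i) (v (finCycSucc i))) :
    ∃ P : PrePolygon X k, P.IsGeodesicPolygon ∧ (∀ i, P.edgeSet i = s i) ∧
      (∀ i, P.edge i 0 = v i) ∧ (∀ i, P.edge i (P.len i) = v (finCycSucc i)) := by
  choose γ ℓ h1 h2 h3 h4 using h
  refine ⟨⟨γ, ℓ⟩, ⟨⟨fun i => (h1 i).1, fun i => ?_⟩, h1⟩, fun i => (h4 i).symm, h2, h3⟩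
  change γ i (ℓ i) = _
  rw [h3]; exact (h2 _).symm

/-- Fat `k`-gons have uniformly bounded diameter. -/
def BoundedFat (X : Type*) [MetricSpace X] (k : ℕ) (θ ν Λ : ℝ) : Prop :=
  ∀ P : PrePolygon X k, P.IsGeodesicPolygon → P.IsFat2 θ ν →
    ∀ p ∈ P.carrier, ∀ q ∈ P.carrier, dist p q ≤ Λ

theorem exists_opp {k : ℕ} (hk : 3 ≤ k) (i : Fin k) :
    ∃ j : Fin k, i ≠ j ∧ finCycSucc i ≠ j := by
  by_contra hcon
  push Not at hcon
  have : (Finset.univ : Finset (Fin k)) ⊆ {i, finCycSucc i} := by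
    intro j _
    by_cases hj : i = j
    · simp [hj]
    · simp [hcon j hj]
  have := (Finset.card_le_card this).trans Finset.card_le_two
  simp at this
  omega

theorem exists_opp' {k : ℕ} (hk : 3 ≤ k) (i : Fin k) :
    ∃ j : Fin k, j ≠ i ∧ finCycSucc j ≠ i := by
  rcases Nat.eq_zero_or_pos i.val with h0 | h0
  · refine ⟨⟨1, by omega⟩, ?_, ?_⟩
    · intro h; have := congrArg Fin.val h; simp at this; omega
    · intro h
      have := congrArg Fin.val h
      simp [finCycSucc] at this
      rw [Nat.mod_eq_of_lt (by omega)] at this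
      omega
  · by_cases h1 : i.val = 1
    · refine ⟨⟨2, by omega⟩, ?_, ?_⟩
      · intro h; have := congrArg Fin.val h; simp at this; omega
      · intro h
        have := congrArg Fin.val h
        simp only [finCycSucc] at this
        rw [h1] at this
        rcases Nat.lt_or_ge 3 k with hk' | hk'
        · rw [Nat.mod_eq_of_lt (by omega)] at this
          omega
        · have : k = 3 := by omega
          subst this
          omega
    · refine ⟨⟨0, by omega⟩, ?_, ?_⟩
      · intro h; have := congrArg Fin.val h; simp at this; omega
      · intro h
        have := congrArg Fin.val h
        simp only [finCycSucc] at this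
        rw [Nat.mod_eq_of_lt (by omega)] at this
        omega

theorem BoundedFat.apply {k : ℕ} {θ ν Λ : ℝ} (hB : BoundedFat X k θ ν Λ) (hk : 3 ≤ k)
    (hθ : 0 < θ) (hν : 8 ≤ ν) (v : Fin k → X) (s : Fin k → Set X)
    (h : ∀ i, IsSeg (s i) (v i) (v (finCycSucc i)))
    (F1 : ∀ i j, i ≠ j → ∀ p ∈ s i, 2 * θ ≤ dist p (v i) → 2 * θ ≤ dist p (v (finCycSucc i)) →
      ∀ q ∈ s j, θ ≤ dist p q)
    (F2 : ∀ i j, j ≠ i → finCycSucc j ≠ i → ∀ q ∈ s j, ν * θ ≤ dist (v i) q)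
    (i j : Fin k) {p q : X} (hp : p ∈ s i) (hq : q ∈ s j) : dist p q ≤ Λ := by
  obtain ⟨P, hP, he, h0, h1⟩ := exists_polygon v s h
  refine hB P hP ⟨fun i p hp hp1 hp2 => ?_, fun i => ?_⟩ p
    (Set.mem_iUnion.2 ⟨i, by rwa [he]⟩) q (Set.mem_iUnion.2 ⟨j, by rwa [he]⟩)
  · rw [he] at hp
    rw [h0] at hp1
    rw [h1] at hp2
    rw [Metric.le_infDist]
    · rintro q ⟨hq, hqi⟩
      obtain ⟨j, hj⟩ := Set.mem_iUnion.1 hq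
      rw [he] at hj hqi
      refine F1 i j ?_ p hp hp1 hp2 q hj
      rintro rfl
      exact hqi hj
    · obtain ⟨j, hj, hj'⟩ := exists_opp hk i
      refine ⟨v j, Set.mem_iUnion.2 ⟨j, by rw [he]; exact (h j).left_mem⟩, ?_⟩
      rw [he]
      intro hmem
      have := F2 j i hj hj' (v j) hmem
      rw [dist_self] at this
      nlinarith
  · have hv : P.vertex i = v i := h0 i
    rw [hv, Metric.le_infDist]
    · intro q hq
      simp only [PrePolygon.opp, Set.mem_iUnion, Set.mem_setOf_eq] at hq
      obtain ⟨j, ⟨hj, hj'⟩, hq⟩ := hq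
      rw [he] at hq
      exact F2 i j hj hj' q hq
    · obtain ⟨j, hj, hj'⟩ := exists_opp' hk i
      refine ⟨v j, ?_⟩
      simp only [PrePolygon.opp, Set.mem_iUnion, Set.mem_setOf_eq]
      exact ⟨j, ⟨hj, hj'⟩, by rw [he]; exact (h j).left_mem⟩

end Segments
/-! ### Bounded fat quadrilaterals and hexagons imply hyperbolicity -/

section Hyp

/-- Bounded fat quadrilaterals: geodesics with endpoints close to a geodesic stay close. -/
theorem quad_lemma (hX : GeodesicSpace X) {θ ν Λ : ℝ} (hθ : 0 < θ) (hν : 8 ≤ ν)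
    (hB : BoundedFat X 4 θ ν Λ) {c : ℝ} (hc : ν * θ ≤ c) {s σ : Set X} {a b C D p : X}
    (hs : IsSeg s a b) (hσ : IsSeg σ C D) (hp : p ∈ s)
    (ha : Metric.infDist a σ ≤ c) (hb : Metric.infDist b σ ≤ c) :
    Metric.infDist p σ ≤ |Λ| + 3 * c + ν * θ := by
  by_contra hcon
  push Not at hcon
  have hs0 : 0 < ν * θ := by positivity
  have hθs : 8 * θ ≤ ν * θ := by nlinarith
  have hΛ := abs_nonneg Λ
  have hΛ' := le_abs_self Λ
  obtain ⟨x, hx, y, hy, e3, he3, hseg3, hpe, hgx, hgy, hfar⟩ :=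
    hs.cut2 hp (Metric.continuous_infDist_pt σ) ha (by linarith : c ≤ Metric.infDist p σ) hb
  obtain ⟨x', hx', hxx⟩ := hσ.isCompact.exists_infDist_eq_dist ⟨C, hσ.left_mem⟩ x
  obtain ⟨y', hy', hyy⟩ := hσ.isCompact.exists_infDist_eq_dist ⟨C, hσ.left_mem⟩ y
  rw [hgx] at hxx
  rw [hgy] at hyy
  have hpx : Metric.infDist p σ ≤ dist p x + c := by
    have := Metric.infDist_le_infDist_add_dist (s := σ) (x := p) (y := x); linarith
  obtain ⟨e1, he1, hseg1⟩ := hσ.sub hx' hy'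
  obtain ⟨e0, hseg0⟩ := hX.seg x x'
  obtain ⟨e2, hseg2⟩ := hX.seg y' y
  have hxy : 2 * c + ν * θ ≤ dist x y := by
    have := hseg3.add hpe
    have h2 := dist_nonneg (x := p) (y := y)
    rw [dist_comm x p] at this
    linarith
  have h13 : ∀ p ∈ e1, ∀ q ∈ e3, c ≤ dist p q := fun p hp q hq => by
    rw [dist_comm]
    exact (hfar q hq).trans (Metric.infDist_le_dist_of_mem (he1 hp))
  have h02 : ∀ p ∈ e0, ∀ q ∈ e2, ν * θ ≤ dist p q := fun p hp q hq => by
    have h1 := hseg0.add hp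
    have h2 := hseg2.add hq
    have h3 := dist_triangle4 x p q y
    have h4 := dist_nonneg (x := p) (y := x')
    have h5 := dist_nonneg (x := y') (y := q)
    rw [dist_comm y' y] at h2
    linarith
  -- near facts
  have n01 : ∀ q ∈ e0, ∀ p ∈ e1, dist q x' ≤ dist p q ∧ dist p x' ≤ 2 * dist p q :=
    fun q hq p hp => hseg0.symm.far hq (by
      rw [dist_comm x' x, ← hxx]; exact h13 p hp x hseg3.left_mem)
  have n03 : ∀ q ∈ e0, ∀ p ∈ e3, dist q x ≤ dist p q ∧ dist p x ≤ 2 * dist p q :=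
    fun q hq p hp => hseg0.far hq (by
      rw [← hxx, dist_comm p]; exact h13 x' hseg1.left_mem p hp)
  have n21 : ∀ q ∈ e2, ∀ p ∈ e1, dist q y' ≤ dist p q ∧ dist p y' ≤ 2 * dist p q :=
    fun q hq p hp => hseg2.far hq (by
      rw [dist_comm y' y, ← hyy]; exact h13 p hp y hseg3.right_mem)
  have n23 : ∀ q ∈ e2, ∀ p ∈ e3, dist q y ≤ dist p q ∧ dist p y ≤ 2 * dist p q :=
    fun q hq p hp => hseg2.symm.far hq (by
      rw [← hyy, dist_comm p]; exact h13 y' hseg1.right_mem p hp)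
  have key := hB.apply (by norm_num) hθ hν ![x, x', y', y] ![e0, e1, e2, e3]
    (by intro i; fin_cases i <;> simp [finCycSucc] <;> first | assumption | exact hseg3.symm)
    (by
      intro i j hij p hp h1 h2 q hq
      fin_cases i <;> fin_cases j <;> simp [finCycSucc] at hij hp h1 h2 hq
      · rw [dist_comm]; linarith [(n01 p hp q hq).1]
      · linarith [h02 p hp q hq]
      · rw [dist_comm]; linarith [(n03 p hp q hq).1]
      · linarith [(n01 q hq p hp).2]
      · linarith [(n21 q hq p hp).2]
      · linarith [h13 p hp q hq]
      · rw [dist_comm]; linarith [h02 q hq p hp]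
      · rw [dist_comm]; linarith [(n21 p hp q hq).1]
      · rw [dist_comm]; linarith [(n23 p hp q hq).1]
      · linarith [(n03 q hq p hp).2]
      · rw [dist_comm]; linarith [h13 q hq p hp]
      · linarith [(n23 q hq p hp).2])
    (by
      intro i j hij hij' q hq
      fin_cases i <;> fin_cases j <;> simp [finCycSucc] at hij hij' hq ⊢
      · rw [dist_comm]; linarith [h13 q hq x hseg3.left_mem]
      · linarith [h02 x hseg0.left_mem q hq]
      · linarith [h02 x' hseg0.right_mem q hq]
      · linarith [h13 x' hseg1.left_mem q hq]
      · rw [dist_comm]; linarith [h02 q hq y' hseg2.left_mem]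
      · linarith [h13 y' hseg1.right_mem q hq]
      · rw [dist_comm]; linarith [h02 q hq y hseg2.right_mem]
      · rw [dist_comm]; linarith [h13 q hq y hseg3.right_mem])
    3 3 hpe hseg3.left_mem
  linarith

/-- The hexagon lemma. -/
theorem hexagon_lemma {θ ν Λ : ℝ} (hθ : 0 < θ) (hν : 8 ≤ ν)
    (hB : BoundedFat X 6 θ ν Λ) {s t : ℝ} (hs : s = ν * θ) (ht : 2 * s ≤ t)
    {x x' z z' y' y : X} {e0 e1 e2 e3 e4 e5 : Set X}
    (hseg0 : IsSeg e0 x x') (hseg1 : IsSeg e1 x' z) (hseg2 : IsSeg e2 z z')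
    (hseg3 : IsSeg e3 z' y') (hseg4 : IsSeg e4 y' y) (hseg5 : IsSeg e5 y x)
    (hxx : dist x x' = t) (hyy : dist y y' = t) (hzz : dist z z' = s)
    (h51 : ∀ p ∈ e5, ∀ q ∈ e1, t ≤ dist p q) (h53 : ∀ p ∈ e5, ∀ q ∈ e3, t ≤ dist p q)
    (h13 : ∀ p ∈ e1, ∀ q ∈ e3, s ≤ dist p q)
    (ha : 4 * s ≤ dist x' z) (hb : 4 * s ≤ dist z' y') (hxy : 2 * t + s ≤ dist x y)
    {p : X} (hp : p ∈ e5) : dist p x ≤ Λ := by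
  have hs0 : 0 < s := by rw [hs]; positivity
  have hθs : 8 * θ ≤ s := by rw [hs]; nlinarith
  have h04 : ∀ p ∈ e0, ∀ q ∈ e4, s ≤ dist p q := fun p hp q hq => by
    have h1 := hseg0.add hp
    have h2 := hseg4.add hq
    have h3 := dist_triangle4 x p q y
    have h4 := dist_nonneg (x := p) (y := x')
    have h5 := dist_nonneg (x := y') (y := q)
    rw [dist_comm y' y] at h2
    linarith
  have n0 : ∀ q ∈ e0, ∀ p, (p ∈ e1 ∨ p ∈ e3) → dist q x' ≤ dist p q ∧ dist p x' ≤ 2 * dist p q :=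
    fun q hq p hp => hseg0.symm.far hq (by
      rw [dist_comm x' x, hxx, dist_comm p]
      rcases hp with hp | hp
      · exact h51 x hseg5.right_mem p hp
      · exact h53 x hseg5.right_mem p hp)
  have n4 : ∀ q ∈ e4, ∀ p, (p ∈ e1 ∨ p ∈ e3) → dist q y' ≤ dist p q ∧ dist p y' ≤ 2 * dist p q :=
    fun q hq p hp => hseg4.far hq (by
      rw [dist_comm y' y, hyy, dist_comm p]
      rcases hp with hp | hp
      · exact h51 y hseg5.left_mem p hp
      · exact h53 y hseg5.left_mem p hp)
  have n05 : ∀ q ∈ e0, ∀ p ∈ e5, dist q x ≤ dist p q ∧ dist p x ≤ 2 * dist p q :=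
    fun q hq p hp => hseg0.far hq (by rw [hxx]; exact h51 p hp x' hseg1.left_mem)
  have n45 : ∀ q ∈ e4, ∀ p ∈ e5, dist q y ≤ dist p q ∧ dist p y ≤ 2 * dist p q :=
    fun q hq p hp => hseg4.symm.far hq (by rw [hyy]; exact h53 p hp y' hseg3.right_mem)
  have n21 : ∀ q ∈ e2, ∀ p ∈ e1, dist q z ≤ dist p q ∧ dist p z ≤ 2 * dist p q :=
    fun q hq p hp => hseg2.far hq (by rw [hzz]; exact h13 p hp z' hseg3.left_mem)
  have n23 : ∀ q ∈ e2, ∀ p ∈ e3, dist q z' ≤ dist p q ∧ dist p z' ≤ 2 * dist p q :=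
    fun q hq p hp => hseg2.symm.far hq (by
      rw [dist_comm z' z, hzz, dist_comm p]; exact h13 z hseg1.right_mem p hp)
  have d2 : ∀ q ∈ e2, dist z q ≤ s ∧ dist z' q ≤ s := fun q hq => by
    have h1 := hseg2.add hq
    have h2 := dist_nonneg (x := z) (y := q)
    have h3 := dist_nonneg (x := q) (y := z')
    rw [dist_comm z' q]
    constructor <;> linarith
  have h02 : ∀ p ∈ e0, ∀ q ∈ e2, s ≤ dist p q := fun p hp q hq => by
    have h1 := (n0 p hp z (Or.inl hseg1.right_mem)).2
    have h2 := (d2 q hq).1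
    have h3 := dist_triangle z q p
    rw [dist_comm z x'] at h1
    rw [dist_comm p q]
    linarith
  have h42 : ∀ p ∈ e4, ∀ q ∈ e2, s ≤ dist p q := fun p hp q hq => by
    have h1 := (n4 p hp z' (Or.inr hseg3.left_mem)).2
    have h2 := (d2 q hq).2
    have h3 := dist_triangle z' q p
    rw [dist_comm p q]
    linarith
  have h52 : ∀ p ∈ e5, ∀ q ∈ e2, s ≤ dist p q := fun p hp q hq => by
    have h1 := h51 p hp z hseg1.right_mem
    have h2 := (d2 q hq).1
    have h3 := dist_triangle p q z
    rw [dist_comm q z] at h3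
    linarith
  refine hB.apply (by norm_num) hθ hν ![x, x', z, z', y', y] ![e0, e1, e2, e3, e4, e5]
    (by intro i; fin_cases i <;> simp [finCycSucc] <;> assumption)
    (by
      intro i j hij p hp h1 h2 q hq
      fin_cases i <;> fin_cases j <;> simp [finCycSucc] at hij hp h1 h2 hq
      · rw [dist_comm]; linarith [(n0 p hp q (Or.inl hq)).1]
      · linarith [h02 p hp q hq]
      · rw [dist_comm]; linarith [(n0 p hp q (Or.inr hq)).1]
      · linarith [h04 p hp q hq]
      · rw [dist_comm]; linarith [(n05 p hp q hq).1]
      · linarith [(n0 q hq p (Or.inl hp)).2]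
      · linarith [(n21 q hq p hp).2]
      · linarith [h13 p hp q hq]
      · linarith [(n4 q hq p (Or.inl hp)).2, h13 p hp y' hseg3.right_mem]
      · rw [dist_comm]; linarith [h51 q hq p hp]
      · rw [dist_comm]; linarith [h02 q hq p hp]
      · rw [dist_comm]; linarith [(n21 p hp q hq).1]
      · rw [dist_comm]; linarith [(n23 p hp q hq).1]
      · rw [dist_comm]; linarith [h42 q hq p hp]
      · rw [dist_comm]; linarith [h52 q hq p hp]
      · linarith [(n0 q hq p (Or.inr hp)).2, h13 x' hseg1.left_mem p hp, dist_comm x' p]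
      · rw [dist_comm]; linarith [h13 q hq p hp]
      · linarith [(n23 q hq p hp).2]
      · linarith [(n4 q hq p (Or.inr hp)).2]
      · rw [dist_comm]; linarith [h53 q hq p hp]
      · rw [dist_comm]; linarith [h04 q hq p hp]
      · rw [dist_comm]; linarith [(n4 p hp q (Or.inl hq)).1]
      · linarith [h42 p hp q hq]
      · rw [dist_comm]; linarith [(n4 p hp q (Or.inr hq)).1]
      · rw [dist_comm]; linarith [(n45 p hp q hq).1]
      · linarith [(n05 q hq p hp).2]
      · linarith [h51 p hp q hq]
      · linarith [h52 p hp q hq]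
      · linarith [h53 p hp q hq]
      · linarith [(n45 q hq p hp).2])
    (by
      intro i j hij hij' q hq
      rw [← hs]
      fin_cases i <;> fin_cases j <;> simp [finCycSucc] at hij hij' hq ⊢
      · linarith [h51 x hseg5.right_mem q hq]
      · exact h52 x hseg5.right_mem q hq
      · linarith [h53 x hseg5.right_mem q hq]
      · exact h04 x hseg0.left_mem q hq
      · exact h02 x' hseg0.right_mem q hq
      · exact h13 x' hseg1.left_mem q hq
      · exact h04 x' hseg0.right_mem q hq
      · rw [dist_comm]; linarith [h51 q hq x' hseg1.left_mem]
      · linarith [(n0 q hq z (Or.inl hseg1.right_mem)).2, dist_comm z x']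
      · exact h13 z hseg1.right_mem q hq
      · linarith [(n4 q hq z (Or.inl hseg1.right_mem)).2, dist_triangle z' z y', dist_comm z z']
      · rw [dist_comm]; linarith [h51 q hq z hseg1.right_mem]
      · linarith [(n0 q hq z' (Or.inr hseg3.left_mem)).2, dist_triangle x' z' z,
          dist_comm z' x', dist_comm z z']
      · rw [dist_comm]; exact h13 q hq z' hseg3.left_mem
      · linarith [(n4 q hq z' (Or.inr hseg3.left_mem)).2]
      · rw [dist_comm]; linarith [h53 q hq z' hseg3.left_mem]
      · rw [dist_comm]; exact h04 q hq y' hseg4.left_mem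
      · rw [dist_comm]; exact h13 q hq y' hseg3.right_mem
      · exact h42 y' hseg4.left_mem q hq
      · rw [dist_comm]; linarith [h53 q hq y' hseg3.right_mem]
      · rw [dist_comm]; exact h04 q hq y hseg4.right_mem
      · linarith [h51 y hseg5.left_mem q hq]
      · exact h52 y hseg5.left_mem q hq
      · linarith [h53 y hseg5.left_mem q hq])
    5 5 hp hseg5.right_mem

/-- The pentagon configuration left after two corners of a triangle are cut. -/
theorem pentagon_lemma (hX : GeodesicSpace X) {θ ν Λ θ' ν' Λ' : ℝ} (hθ : 0 < θ) (hν : 8 ≤ ν)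
    (hB : BoundedFat X 4 θ ν Λ) (hθ' : 0 < θ') (hν' : 8 ≤ ν')
    (hB' : BoundedFat X 6 θ' ν' Λ') {s t c : ℝ} (hs : s = ν' * θ') (ht : t = 2 * s)
    (hc : c = t + 5 * s + ν * θ) {x y x' y' C p : X} {e τ τ' U : Set X}
    (he : IsSeg e x y) (hp : p ∈ e) (hfar : ∀ q ∈ e, ∀ r ∈ U, t ≤ dist q r)
    (hxx : dist x x' = t) (hyy : dist y y' = t) (hτ : IsSeg τ x' C) (hτ' : IsSeg τ' y' C)
    (hτU : τ ⊆ U) (hτU' : τ' ⊆ U) :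
    Metric.infDist p U ≤ |Λ| + 3 * c + ν * θ + |Λ'| := by
  have hs0 : 0 < s := by rw [hs]; positivity
  have hn0 : 0 < ν * θ := by positivity
  have hΛ := abs_nonneg Λ
  have hΛ1 := abs_nonneg Λ'
  have hΛ2 := le_abs_self Λ'
  have mono : ∀ σ ⊆ U, σ.Nonempty → Metric.infDist p U ≤ Metric.infDist p σ :=
    fun σ h h' => Metric.infDist_le_infDist_of_subset h h'
  have viaτ' : (∃ w ∈ τ', dist x w ≤ c) →
      Metric.infDist p U ≤ |Λ| + 3 * c + ν * θ + |Λ'| := by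
    rintro ⟨w, hw, hxw⟩
    have := quad_lemma hX hθ hν hB (c := c) (by linarith) he hτ' hp
      ((Metric.infDist_le_dist_of_mem hw).trans hxw)
      ((Metric.infDist_le_dist_of_mem hτ'.left_mem).trans (by linarith))
    linarith [mono τ' hτU' ⟨_, hτ'.left_mem⟩]
  have viaτ : (∃ w ∈ τ, dist y w ≤ c) →
      Metric.infDist p U ≤ |Λ| + 3 * c + ν * θ + |Λ'| := by
    rintro ⟨w, hw, hxw⟩
    have := quad_lemma hX hθ hν hB (c := c) (by linarith) he hτ hp
      ((Metric.infDist_le_dist_of_mem hτ.left_mem).trans (by linarith))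
      ((Metric.infDist_le_dist_of_mem hw).trans hxw)
    linarith [mono τ hτU ⟨_, hτ.left_mem⟩]
  by_cases h1 : s ≤ Metric.infDist x' τ'
  swap
  · obtain ⟨w, hw, hxw⟩ := (Metric.infDist_lt_iff ⟨_, hτ'.left_mem⟩).1 (not_le.1 h1)
    exact viaτ' ⟨w, hw, by linarith [dist_triangle x x' w]⟩
  obtain ⟨z, hz, e1, he1, hseg1, hgz, hfar1⟩ := hτ.cut1 (Metric.continuous_infDist_pt τ') h1
    (by rw [Metric.infDist_zero_of_mem hτ'.right_mem]; exact hs0.le)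
  obtain ⟨z', hz', hzz⟩ := hτ'.isCompact.exists_infDist_eq_dist ⟨_, hτ'.left_mem⟩ z
  rw [hgz] at hzz
  by_cases ha : 4 * s ≤ dist x' z
  swap
  · exact viaτ' ⟨z', hz', by linarith [dist_triangle4 x x' z z']⟩
  by_cases hb : 4 * s ≤ dist z' y'
  swap
  · refine viaτ ⟨z, hz, ?_⟩
    have := dist_triangle4 y y' z' z
    rw [dist_comm y' z', dist_comm z' z] at this
    linarith
  by_cases hxy : 2 * t + s ≤ dist x p
  swap
  · have h2 := Metric.infDist_le_dist_of_mem (x := p) (hτU hτ.left_mem)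
    have h3 := dist_triangle p x x'
    rw [dist_comm p x] at h3
    linarith
  obtain ⟨e3, he3, hseg3⟩ := hτ'.sub hz' hτ'.left_mem
  obtain ⟨e0, hseg0⟩ := hX.seg x x'
  obtain ⟨e2, hseg2⟩ := hX.seg z z'
  obtain ⟨e4, hseg4⟩ := hX.seg y' y
  have := hexagon_lemma hθ' hν' hB' hs ht.ge hseg0 hseg1 hseg2 hseg3 hseg4 he.symm hxx hyy hzz.symm
    (fun p hp q hq => hfar p hp q (hτU (he1 hq)))
    (fun p hp q hq => hfar p hp q (hτU' (he3 hq)))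
    (fun p hp q hq => (hfar1 p hp).trans (Metric.infDist_le_dist_of_mem (he3 hq)))
    ha hb (by linarith [he.add hp, dist_nonneg (x := p) (y := y)]) hp
  have h2 := Metric.infDist_le_dist_of_mem (x := p) (hτU hτ.left_mem)
  have h3 := dist_triangle p x x'
  linarith

theorem finCycSucc_three (i : Fin 3) : finCycSucc (finCycSucc (finCycSucc i)) = i := by
  fin_cases i <;> rfl

/-- Bounded fat quadrilaterals and hexagons imply hyperbolicity. -/
theorem hyperbolic_of_boundedFat (hX : GeodesicSpace X) {θ ν Λ θ' ν' Λ' : ℝ} (hθ : 0 < θ)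
    (hν : 8 ≤ ν) (hB : BoundedFat X 4 θ ν Λ) (hθ' : 0 < θ') (hν' : 8 ≤ ν')
    (hB' : BoundedFat X 6 θ' ν' Λ') : GromovHyperbolic X := by
  obtain ⟨s, hs⟩ : ∃ s, s = ν' * θ' := ⟨_, rfl⟩
  obtain ⟨t, ht⟩ : ∃ t, t = 2 * s := ⟨_, rfl⟩
  obtain ⟨c, hc⟩ : ∃ c, c = t + 5 * s + ν * θ := ⟨_, rfl⟩
  have hs0 : 0 < s := by rw [hs]; positivity
  have hn0 : 0 < ν * θ := by positivity
  have hΛ := abs_nonneg Λ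
  have hΛ1 := abs_nonneg Λ'
  refine ⟨|Λ| + 3 * c + ν * θ + |Λ'|, by linarith, fun T hT i p hp => ?_⟩
  have hseg : ∀ i, IsSeg (T.edgeSet i) (T.edge i 0) (T.edge (finCycSucc i) 0) := fun i =>
    ⟨T.edge i, T.len i, hT.2 i, rfl, hT.1.2 i, rfl⟩
  have s0 := hseg i
  have s1 := hseg (finCycSucc i)
  have s2 := hseg (finCycSucc (finCycSucc i))
  rw [finCycSucc_three] at s2
  set U := T.edgeSet (finCycSucc i) ∪ T.edgeSet (finCycSucc (finCycSucc i)) with hU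
  by_contra hcon
  push Not at hcon
  have hUne : U.Nonempty := ⟨_, Or.inl s1.left_mem⟩
  obtain ⟨x, hx, y, hy, e, he, hsege, hpe, hgx, hgy, hfar⟩ :=
    s0.cut2 hp (Metric.continuous_infDist_pt U) (c := t)
      (by rw [Metric.infDist_zero_of_mem (hU ▸ Set.mem_union_right _ s2.right_mem)]; linarith)
      (by linarith)
      (by rw [Metric.infDist_zero_of_mem (hU ▸ Set.mem_union_left _ s1.left_mem)]; linarith)
  have hUc : IsCompact U := s1.isCompact.union s2.isCompact
  obtain ⟨x', hx', hxx⟩ := hUc.exists_infDist_eq_dist hUne x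
  obtain ⟨y', hy', hyy⟩ := hUc.exists_infDist_eq_dist hUne y
  rw [hgx] at hxx
  rw [hgy] at hyy
  have hfar' : ∀ q ∈ e, ∀ r ∈ U, t ≤ dist q r := fun q hq r hr =>
    (hfar q hq).trans (Metric.infDist_le_dist_of_mem hr)
  have same : ∀ {σ : Set X} {A B : X}, IsSeg σ A B → σ ⊆ U → x' ∈ σ → y' ∈ σ → False := by
    intro σ A B hσ hσU hxσ hyσ
    have := quad_lemma hX hθ hν hB (c := c) (by linarith) hsege hσ hpe
      ((Metric.infDist_le_dist_of_mem hxσ).trans (by linarith))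
      ((Metric.infDist_le_dist_of_mem hyσ).trans (by linarith))
    have h2 : Metric.infDist p U ≤ Metric.infDist p σ :=
      Metric.infDist_le_infDist_of_subset hσU ⟨_, hxσ⟩
    linarith
  rcases hx' with hx' | hx' <;> rcases hy' with hy' | hy'
  · exact same s1 Set.subset_union_left hx' hy'
  · obtain ⟨τ, hτ, hτs⟩ := s1.sub hx' s1.right_mem
    obtain ⟨τ', hτ', hτs'⟩ := s2.sub hy' s2.left_mem
    have := pentagon_lemma hX hθ hν hB hθ' hν' hB' hs ht hc hsege hpe hfar' hxx.symm hyy.symm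
      hτs hτs' (fun q hq => Or.inl (hτ hq)) (fun q hq => Or.inr (hτ' hq))
    linarith
  · obtain ⟨τ, hτ, hτs⟩ := s2.sub hx' s2.left_mem
    obtain ⟨τ', hτ', hτs'⟩ := s1.sub hy' s1.right_mem
    have := pentagon_lemma hX hθ hν hB hθ' hν' hB' hs ht hc hsege hpe hfar' hxx.symm hyy.symm
      hτs hτs' (fun q hq => Or.inr (hτ hq)) (fun q hq => Or.inl (hτ' hq))
    linarith
  · exact same s2 Set.subset_union_right hx' hy'

end Hyp
/-! ### Word metric facts -/

section Words

variable {G : Type*} [Group G] {S : Set G}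

theorem exists_word (hS : Subgroup.closure S = ⊤) (g : G) :
    ∃ l : List G, l.length = wordNorm S g ∧ (∀ x ∈ l, x ∈ S ∨ x⁻¹ ∈ S) ∧ l.prod = g := by
  have hne : {n : ℕ | ∃ l : List G, l.length = n ∧ (∀ x ∈ l, x ∈ S ∨ x⁻¹ ∈ S) ∧
      l.prod = g}.Nonempty := by
    have hg : g ∈ Subgroup.closure S := by rw [hS]; trivial
    rw [← Subgroup.mem_toSubmonoid, Subgroup.closure_toSubmonoid] at hg
    obtain ⟨l, h1, h2⟩ := Submonoid.exists_list_of_mem_closure hg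
    exact ⟨l.length, l, rfl, h1, h2⟩
  exact Nat.sInf_mem hne

theorem wordNorm_prod_le {l : List G} (hl : ∀ x ∈ l, x ∈ S ∨ x⁻¹ ∈ S) :
    wordNorm S l.prod ≤ l.length := Nat.sInf_le ⟨l, rfl, hl, rfl⟩

theorem finite_words (hS : S.Finite) (n : ℕ) :
    {g : G | ∃ l : List G, l.length = n ∧ (∀ x ∈ l, x ∈ S ∨ x⁻¹ ∈ S) ∧ l.prod = g}.Finite := by
  induction n with
  | zero =>
    refine (Set.finite_singleton (1 : G)).subset ?_
    rintro g ⟨l, h1, -, rfl⟩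
    rw [List.length_eq_zero_iff.1 h1]; simp
  | succ n ih =>
    have hT : {x : G | x ∈ S ∨ x⁻¹ ∈ S}.Finite := by
      refine (hS.union (hS.image (fun x => x⁻¹))).subset ?_
      rintro x (hx | hx)
      · exact Or.inl hx
      · exact Or.inr ⟨x⁻¹, hx, by simp⟩
    refine (Set.Finite.image2 (fun a b => a * b) hT ih).subset ?_
    rintro g ⟨l, h1, h2, rfl⟩
    obtain ⟨a, l, rfl⟩ := List.exists_cons_of_length_eq_add_one h1
    exact ⟨a, h2 a (by simp), l.prod, ⟨l, by simpa using h1, fun x hx => h2 x (by simp [hx]), rfl⟩,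
      by simp⟩

theorem finite_ball (hfin : S.Finite) (hS : Subgroup.closure S = ⊤) (n : ℕ) :
    {g : G | wordNorm S g ≤ n}.Finite := by
  refine (Set.Finite.biUnion (Set.finite_Iic n) (fun i _ => finite_words hfin i)).subset ?_
  intro g hg
  obtain ⟨l, h1, h2, h3⟩ := exists_word hS g
  exact Set.mem_biUnion (show wordNorm S g ∈ Set.Iic n from hg) ⟨l, h1, h2, h3⟩

end Words

section Model

variable {G : Type*} [Group G] {S : Set G} [MulAction G X] {x₀ : X}

theorem IsCayleyModel.dist_smul (hm : IsCayleyModel G S X x₀) (g : G) (x y : X) :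
    dist (g • x) (g • y) = dist x y := (hm.2.2.2.1 g).dist_eq x y

theorem IsCayleyModel.dist_eq (hm : IsCayleyModel G S X x₀) (a b : G) :
    dist (a • x₀) (b • x₀) = (wordNorm S (a⁻¹ * b) : ℝ) := hm.2.2.2.2.1 a b

theorem IsCayleyModel.dist_one (hm : IsCayleyModel G S X x₀) (b : G) :
    dist x₀ (b • x₀) = (wordNorm S b : ℝ) := by
  have := hm.dist_eq 1 b
  simpa using this

theorem IsCayleyModel.exists_between (hm : IsCayleyModel G S X x₀) (a b : G) (i : ℕ)
    (hi : i ≤ wordNorm S (a⁻¹ * b)) :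
    ∃ c : G, wordNorm S (a⁻¹ * c) = i ∧ wordNorm S (c⁻¹ * b) + i = wordNorm S (a⁻¹ * b) := by
  obtain ⟨l, h1, h2, h3⟩ := exists_word hm.2.1 (a⁻¹ * b)
  have hl := List.prod_take_mul_prod_drop l i
  rw [h3] at hl
  have e1 : wordNorm S (l.take i).prod ≤ i :=
    (wordNorm_prod_le (fun x hx => h2 x (List.mem_of_mem_take hx))).trans (by simp)
  have e2 : wordNorm S (l.drop i).prod ≤ wordNorm S (a⁻¹ * b) - i :=
    (wordNorm_prod_le (fun x hx => h2 x (List.mem_of_mem_drop hx))).trans (by simp [h1])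
  have q1 : a⁻¹ * (a * (l.take i).prod) = (l.take i).prod := by group
  have q2 : (a * (l.take i).prod)⁻¹ * b = (l.drop i).prod := by
    rw [mul_inv_rev, mul_assoc, ← hl]; group
  have h := dist_triangle (a • x₀) ((a * (l.take i).prod) • x₀) (b • x₀)
  rw [hm.dist_eq, hm.dist_eq, hm.dist_eq] at h
  refine ⟨a * (l.take i).prod, ?_⟩
  rw [q1, q2] at *
  have h' : wordNorm S (a⁻¹ * b) ≤ wordNorm S (l.take i).prod + wordNorm S (l.drop i).prod := by
    exact_mod_cast h
  omega

theorem geodesic_of_lipschitz {γ : ℝ → X} {ℓ : ℝ} (h0 : 0 ≤ ℓ)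
    (h : ∀ s t, 0 ≤ s → s ≤ t → t ≤ ℓ → dist (γ s) (γ t) ≤ t - s) (he : ℓ ≤ dist (γ 0) (γ ℓ)) :
    IsGeodesicParam γ ℓ := by
  have key : ∀ s t, 0 ≤ s → s ≤ t → t ≤ ℓ → dist (γ s) (γ t) = t - s := by
    intro s t hs hst ht
    have h1 := h 0 s le_rfl hs (hst.trans ht)
    have h2 := h t ℓ (hs.trans hst) ht le_rfl
    have h3 := h s t hs hst ht
    have h4 := dist_triangle4 (γ 0) (γ s) (γ t) (γ ℓ)
    linarith
  refine ⟨h0, fun s hs t ht => ?_⟩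
  rcases le_total s t with hst | hst
  · rw [key s t hs.1 hst ht.2, abs_sub_comm, abs_of_nonneg (by linarith)]
  · rw [dist_comm, key t s ht.1 hst hs.2, abs_of_nonneg (by linarith)]

theorem IsGeodesicParam.len_eq {γ : ℝ → X} {ℓ : ℝ} (h : IsGeodesicParam γ ℓ) :
    dist (γ 0) (γ ℓ) = ℓ := by
  rw [h.2 0 ⟨le_rfl, h.1⟩ ℓ ⟨h.1, le_rfl⟩, zero_sub, abs_neg, abs_of_nonneg h.1]

/-- A geodesic passing through a prescribed intermediate point. -/
theorem exists_geodesic_through (hX : GeodesicSpace X) {a c b : X}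
    (h : dist a c + dist c b = dist a b) :
    ∃ γ : ℝ → X, IsGeodesicParam γ (dist a b) ∧ γ 0 = a ∧ γ (dist a c) = c ∧
      γ (dist a b) = b := by
  obtain ⟨γ₁, ℓ₁, h1, h10, h11⟩ := hX a c
  obtain ⟨γ₂, ℓ₂, h2, h20, h21⟩ := hX c b
  have e1 : dist a c = ℓ₁ := by rw [← h10, ← h11]; exact h1.len_eq
  have e2 : dist c b = ℓ₂ := by rw [← h20, ← h21]; exact h2.len_eq
  have e3 : dist a b = ℓ₁ + ℓ₂ := by linarith
  have p1 := h1.1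
  have p2 := h2.1
  rw [e3, e1]
  let γ : ℝ → X := fun t => if t ≤ ℓ₁ then γ₁ t else γ₂ (t - ℓ₁)
  have v0 : γ 0 = a := by simp [γ, p1, h10]
  have v1 : γ ℓ₁ = c := by simp [γ, h11]
  have v2 : γ (ℓ₁ + ℓ₂) = b := by
    by_cases hz : ℓ₂ = 0
    · subst hz
      simp [γ, h11, ← h21, h20]
    · have : ¬ (ℓ₁ + ℓ₂ ≤ ℓ₁) := by
        intro hh; apply hz; linarith
      simp only [γ, this, if_false]
      rw [← h21]; congr 1; ring
  have l1 : ∀ s t, 0 ≤ s → s ≤ t → t ≤ ℓ₁ → dist (γ s) (γ t) ≤ t - s := by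
    intro s t hs hst ht
    simp only [γ, ht, hst.trans ht, if_true]
    rw [h1.2 s ⟨hs, hst.trans ht⟩ t ⟨hs.trans hst, ht⟩, abs_sub_comm, abs_of_nonneg (by linarith)]
  have g2 : ∀ t, ℓ₁ ≤ t → γ t = γ₂ (t - ℓ₁) := by
    intro t ht
    rcases ht.eq_or_lt with rfl | ht
    · rw [v1, sub_self, h20]
    · simp only [γ, not_le.2 ht, if_false]
  have l2 : ∀ s t, ℓ₁ ≤ s → s ≤ t → t ≤ ℓ₁ + ℓ₂ → dist (γ s) (γ t) ≤ t - s := by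
    intro s t hs hst ht
    rw [g2 s hs, g2 t (hs.trans hst),
      h2.2 _ ⟨by linarith, by linarith⟩ _ ⟨by linarith, by linarith⟩, abs_sub_comm,
      abs_of_nonneg (by linarith)]
    linarith
  refine ⟨γ, geodesic_of_lipschitz (by linarith) ?_ ?_, v0, v1, v2⟩
  · intro s t hs hst ht
    rcases le_total t ℓ₁ with h' | h'
    · exact l1 s t hs hst h'
    · rcases le_total s ℓ₁ with h'' | h''
      · have := l1 s ℓ₁ hs h'' le_rfl
        have := l2 ℓ₁ t le_rfl h' ht
        have := dist_triangle (γ s) (γ ℓ₁) (γ t)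
        linarith
      · exact l2 s t h'' hst ht
  · rw [v0, v2, e3]

/-! ### The sets `B_f` -/

theorem tubN_mono {K K' : ℝ} (h : K ≤ K') (A : Set X) : tubN K A ⊆ tubN K' A :=
  fun _ hx => lt_of_lt_of_le hx h

theorem mem_tubN_of_dist {K r : ℝ} {A : Set X} {x y : X} (hx : x ∈ tubN K A) (h : dist x y ≤ r) :
    y ∈ tubN (K + r) A := by
  have h1 : Metric.infDist x A < K := hx
  have h2 := Metric.infDist_le_infDist_add_dist (s := A) (x := y) (y := x)
  rw [dist_comm y x] at h2
  change Metric.infDist y A < K + r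
  linarith

/-- Points all of whose translates are close to the prescribed pieces. -/
def Bset (K : ℝ) (f : G → Set X) : Set X := {x | ∀ g : G, g • x ∈ tubN K (f g)}

/-- Translation of a prescription. -/
def ptrans (a : G) (f : G → Set X) : G → Set X := fun g => f (g * a)

theorem ptrans_mul (a b : G) (f : G → Set X) : ptrans a (ptrans b f) = ptrans (a * b) f := by
  funext g; simp [ptrans, mul_assoc]

theorem ptrans_one (f : G → Set X) : ptrans 1 f = f := by
  funext g; simp [ptrans]

theorem smul_mem_Bset {K : ℝ} {f : G → Set X} (a : G) {x : X} :
    a • x ∈ Bset K f ↔ x ∈ Bset K (ptrans a⁻¹ f) := by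
  constructor
  · intro h g
    have := h (g * a⁻¹)
    rw [smul_smul] at this
    simpa [ptrans] using this
  · intro h g
    have := h (g * a)
    rw [smul_smul]
    simpa [ptrans] using this

theorem Bset_mono {K K' : ℝ} (h : K ≤ K') (f : G → Set X) : Bset K f ⊆ Bset K' f :=
  fun _ hx g => tubN_mono h _ (hx g)

theorem mem_Bset_of_dist (hm : IsCayleyModel G S X x₀) {K r : ℝ} {f : G → Set X} {x y : X}
    (hx : x ∈ Bset K f) (h : dist x y ≤ r) : y ∈ Bset (K + r) f := fun g =>
  mem_tubN_of_dist (hx g) (by rwa [hm.dist_smul])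

variable {𝓑 : Set (Set X)} {ε M : ℝ}

theorem Bset_mid (hm : IsCayleyModel G S X x₀) (hβ : Beta2With 𝓑 ε M) {f : G → Set X}
    (hf : ∀ g, f g ∈ 𝓑) {K ℓ : ℝ} {γ : ℝ → X} (hγ : IsGeodesicParam γ ℓ) (hK : K ≤ ε * ℓ)
    (h0 : γ 0 ∈ Bset K f) (h1 : γ ℓ ∈ Bset K f) {t : ℝ} (ht : t ∈ Set.Icc (ℓ / 3) (2 * ℓ / 3)) :
    γ t ∈ Bset M f := fun g =>
  hβ (fun t => g • γ t) ℓ ⟨hγ.1, fun s hs t ht => by rw [hm.dist_smul]; exact hγ.2 s hs t ht⟩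
    (f g) (hf g) (tubN_mono hK _ (h0 g)) (tubN_mono hK _ (h1 g)) t ht

theorem orbit_mid (hm : IsCayleyModel G S X x₀) (hβ : Beta2With 𝓑 ε M) {f : G → Set X}
    (hf : ∀ g, f g ∈ 𝓑) {K : ℝ} {a b : G} (ha : a • x₀ ∈ Bset K f) (hb : b • x₀ ∈ Bset K f)
    {n i : ℕ} (hn : wordNorm S (a⁻¹ * b) = n) (hK : K ≤ ε * n) (hi : n ≤ 3 * i)
    (hi' : 3 * i ≤ 2 * n) :
    ∃ c : G, c • x₀ ∈ Bset M f ∧ wordNorm S (a⁻¹ * c) = i ∧ wordNorm S (c⁻¹ * b) + i = n := by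
  obtain ⟨c, hc1, hc2⟩ := hm.exists_between a b i (by omega)
  rw [hn] at hc2
  refine ⟨c, ?_, hc1, hc2⟩
  have hd1 := hm.dist_eq a c
  have hd2 := hm.dist_eq c b
  have hd3 := hm.dist_eq a b
  rw [hc1] at hd1
  rw [hn] at hd3
  have hc2' : (wordNorm S (c⁻¹ * b) : ℝ) + i = n := by exact_mod_cast hc2
  obtain ⟨γ, hγ, h0, h1, h2⟩ := exists_geodesic_through hm.2.2.1 (a := a • x₀) (c := c • x₀)
    (b := b • x₀) (by linarith)
  rw [hd3] at hγ h2
  rw [hd1] at h1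
  rw [← h1]
  have hi1 : (n : ℝ) ≤ 3 * i := by exact_mod_cast hi
  have hi2 : 3 * (i : ℝ) ≤ 2 * n := by exact_mod_cast hi'
  exact Bset_mid hm hβ hf hγ hK (by rwa [h0]) (by rwa [h2]) ⟨by linarith, by linarith⟩

/-- Orbit points of `B_f^K` are close to orbit points of `B_f^M`. -/
theorem orbit_near (hm : IsCayleyModel G S X x₀) (hε : 0 < ε) (hβ : Beta2With 𝓑 ε M) {K : ℝ}
    (hMK : M ≤ K) :
    ∃ N : ℕ, ∀ f : G → Set X, (∀ g, f g ∈ 𝓑) → ∀ r : G, r • x₀ ∈ Bset M f →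
      ∀ a : G, a • x₀ ∈ Bset K f → ∃ r' : G, r' • x₀ ∈ Bset M f ∧ wordNorm S (a⁻¹ * r') ≤ N := by
  obtain ⟨N, hN⟩ := exists_nat_ge (K / ε)
  refine ⟨N + 3, fun f hf r hr a ha => ?_⟩
  suffices H : ∀ n : ℕ, ∀ r : G, r • x₀ ∈ Bset M f → wordNorm S (a⁻¹ * r) = n →
      ∃ r' : G, r' • x₀ ∈ Bset M f ∧ wordNorm S (a⁻¹ * r') ≤ N + 3 from H _ r hr rfl
  intro n
  induction n using Nat.strong_induction_on with
  | _ n ih =>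
    intro r hr hn
    by_cases hle : n ≤ N + 3
    · exact ⟨r, hr, by omega⟩
    · have hnN : (N : ℝ) ≤ n := by exact_mod_cast (by omega : N ≤ n)
      have hK : K ≤ ε * n := by
        rw [div_le_iff₀ hε] at hN
        nlinarith
      obtain ⟨c, hc, hc1, hc2⟩ := orbit_mid hm hβ hf ha (Bset_mono hMK f hr) hn hK
        (i := (n + 2) / 3) (by omega) (by omega)
      exact ih _ (by omega) c hc hc1

theorem Bset_alpha1 (hm : IsCayleyModel G S X x₀) (hα : Alpha1 𝓑) {K : ℝ} (hK : 0 < K) :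
    ∃ D : ℝ, ∀ f f' : G → Set X, (∀ g, f g ∈ 𝓑) → (∀ g, f' g ∈ 𝓑) → f ≠ f' →
      ∀ x y : X, x ∈ Bset K f → x ∈ Bset K f' → y ∈ Bset K f → y ∈ Bset K f' → dist x y ≤ D := by
  obtain ⟨D, hD⟩ := hα K hK
  refine ⟨D, fun f f' hf hf' hne x y hx hx' hy hy' => ?_⟩
  obtain ⟨g, hg⟩ := Function.ne_iff.1 hne
  have := hD _ (hf g) _ (hf' g) hg (g • x) ⟨hx g, hx' g⟩ (g • y) ⟨hy g, hy' g⟩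
  rwa [hm.dist_smul] at this

/-- Good prescriptions: the orbit part of `B_f^M` is large. -/
def Good (S : Set G) (x₀ : X) (𝓑 : Set (Set X)) (M : ℝ) (T : ℕ) (f : G → Set X) : Prop :=
  (∀ g, f g ∈ 𝓑) ∧ ∃ a b : G, a • x₀ ∈ Bset M f ∧ b • x₀ ∈ Bset M f ∧
    2 * T ≤ wordNorm S (a⁻¹ * b)

theorem Good.ptrans {T : ℕ} {f : G → Set X} (h : Good S x₀ 𝓑 M T f) (c : G) :
    Good S x₀ 𝓑 M T (ptrans c f) := by
  obtain ⟨hf, a, b, ha, hb, hab⟩ := h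
  refine ⟨fun g => hf _, c * a, c * b, ?_, ?_, ?_⟩
  · rw [mul_smul, smul_mem_Bset, ptrans_mul, inv_mul_cancel, ptrans_one]; exact ha
  · rw [mul_smul, smul_mem_Bset, ptrans_mul, inv_mul_cancel, ptrans_one]; exact hb
  · rwa [show (c * a)⁻¹ * (c * b) = a⁻¹ * b by group]

theorem finite_good (hm : IsCayleyModel G S X x₀) (hε : 0 < ε) (hβ : Beta2With 𝓑 ε M)
    {K D : ℝ} (hMK : M ≤ K) {T : ℕ}
    (hD : ∀ f f' : G → Set X, (∀ g, f g ∈ 𝓑) → (∀ g, f' g ∈ 𝓑) → f ≠ f' →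
      ∀ x y : X, x ∈ Bset K f → x ∈ Bset K f' → y ∈ Bset K f → y ∈ Bset K f' → dist x y ≤ D)
    (hT : D < T) : {f : G → Set X | Good S x₀ 𝓑 M T f ∧ x₀ ∈ Bset M f}.Finite := by
  obtain ⟨N, hN⟩ := exists_nat_ge (M / ε)
  have ex : ∀ f : G → Set X, ∃ r : G, (Good S x₀ 𝓑 M T f ∧ x₀ ∈ Bset M f) →
      r • x₀ ∈ Bset M f ∧ T ≤ wordNorm S r ∧ wordNorm S r ≤ 3 * T + 3 + N := by
    intro f
    by_cases h : Good S x₀ 𝓑 M T f ∧ x₀ ∈ Bset M f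
    swap
    · exact ⟨1, fun h' => absurd h' h⟩
    obtain ⟨⟨hf, a, b, ha, hb, hab⟩, h1⟩ := h
    have h1' : (1 : G) • x₀ ∈ Bset M f := by rwa [one_smul]
    suffices H : ∀ n : ℕ, ∀ r : G, r • x₀ ∈ Bset M f → wordNorm S r = n → T ≤ n →
        ∃ r : G, r • x₀ ∈ Bset M f ∧ T ≤ wordNorm S r ∧ wordNorm S r ≤ 3 * T + 3 + N by
      have htri := dist_triangle (a • x₀) x₀ (b • x₀)
      rw [dist_comm _ x₀, hm.dist_one, hm.dist_one, hm.dist_eq] at htri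
      have htri' : wordNorm S (a⁻¹ * b) ≤ wordNorm S a + wordNorm S b := by exact_mod_cast htri
      rcases le_total T (wordNorm S a) with h | h
      · obtain ⟨r, hr⟩ := H _ a ha rfl h
        exact ⟨r, fun _ => hr⟩
      · obtain ⟨r, hr⟩ := H _ b hb rfl (by omega)
        exact ⟨r, fun _ => hr⟩
    intro n
    induction n using Nat.strong_induction_on with
    | _ n ih =>
      intro r hr hn hTn
      by_cases hle : n ≤ 3 * T + 3 + N
      · exact ⟨r, hr, by omega, by omega⟩
      · have hnN : (N : ℝ) ≤ n := by exact_mod_cast (by omega : N ≤ n)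
        have hK : M ≤ ε * n := by
          rw [div_le_iff₀ hε] at hN
          nlinarith
        obtain ⟨c, hc, hc1, hc2⟩ := orbit_mid hm hβ hf h1' hr (by simpa using hn) hK
          (i := (n + 2) / 3) (by omega) (by omega)
        exact ih ((n + 2) / 3) (by omega) c hc (by simpa using hc1) (by omega)
  choose ρ hρ using ex
  refine Set.Finite.of_finite_image (f := ρ)
    ((finite_ball hm.1 hm.2.1 (3 * T + 3 + N)).subset ?_) ?_
  · rintro _ ⟨f, hf, rfl⟩
    exact (hρ f hf).2.2
  · intro f hf f' hf' heq
    by_contra hne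
    have h1 := hρ f hf
    have h2 := hρ f' hf'
    rw [← heq] at h2
    have := hD f f' hf.1.1 hf'.1.1 hne x₀ (ρ f • x₀) (Bset_mono hMK _ hf.2) (Bset_mono hMK _ hf'.2)
      (Bset_mono hMK _ h1.1) (Bset_mono hMK _ h2.1)
    rw [hm.dist_one] at this
    have h3 : (T : ℝ) ≤ wordNorm S (ρ f) := by exact_mod_cast h1.2.1
    linarith

end Model
/-! ### Fat polygons and good prescriptions -/

section Fat

variable {G : Type*} [Group G] {S : Set G} [MulAction G X] {x₀ : X}
variable {𝓑 : Set (Set X)} {ε M : ℝ}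

theorem good_of_far (hm : IsCayleyModel G S X x₀) (hε : 0 < ε) (hβ : Beta2With 𝓑 ε M)
    (K : ℝ) (T : ℕ) :
    ∃ Λ : ℝ, ∀ f : G → Set X, (∀ g, f g ∈ 𝓑) → ∀ x ∈ Bset K f, ∀ y ∈ Bset K f,
      Λ ≤ dist x y → Good S x₀ 𝓑 M T f := by
  obtain ⟨N, hN⟩ := exists_nat_ge ((K + 1 / 2) / ε)
  refine ⟨N + 6 * T + 11, fun f hf x hx y hy hxy => ?_⟩
  obtain ⟨a, ha⟩ := hm.2.2.2.2.2 x
  obtain ⟨b, hb⟩ := hm.2.2.2.2.2 y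
  have ha' := mem_Bset_of_dist hm hx ha
  have hb' := mem_Bset_of_dist hm hy hb
  have htri := dist_triangle4 x (a • x₀) (b • x₀) y
  rw [dist_comm (b • x₀) y, hm.dist_eq] at htri
  obtain ⟨n, hn⟩ : ∃ n, wordNorm S (a⁻¹ * b) = n := ⟨_, rfl⟩
  rw [hn] at htri
  have hn1 : ((N + 6 * T + 10 : ℕ) : ℝ) ≤ n := by push_cast; linarith
  have hn2 : N + 6 * T + 10 ≤ n := by exact_mod_cast hn1
  have hnN : (N : ℝ) ≤ n := by exact_mod_cast (by omega : N ≤ n)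
  have hK : K + 1 / 2 ≤ ε * n := by
    rw [div_le_iff₀ hε] at hN
    nlinarith
  obtain ⟨c, hc, hc1, -⟩ := orbit_mid hm hβ hf ha' hb' hn hK (i := (n + 2) / 3)
    (by omega) (by omega)
  obtain ⟨d, hd, hd1, -⟩ := orbit_mid hm hβ hf ha' hb' hn hK (i := 2 * n / 3)
    (by omega) (by omega)
  refine ⟨hf, c, d, hc, hd, ?_⟩
  have h := dist_triangle (a • x₀) (c • x₀) (d • x₀)
  rw [hm.dist_eq, hm.dist_eq, hm.dist_eq, hc1, hd1] at h
  have h' : 2 * n / 3 ≤ (n + 2) / 3 + wordNorm S (c⁻¹ * d) := by exact_mod_cast h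
  omega

/-- Translate of a polygon. -/
def smulPoly {k : ℕ} (g : G) (P : PrePolygon X k) : PrePolygon X k :=
  ⟨fun i t => g • P.edge i t, P.len⟩

theorem smulPoly_edgeSet {k : ℕ} (g : G) (P : PrePolygon X k) (i : Fin k) :
    (smulPoly g P).edgeSet i = (fun x => g • x) '' P.edgeSet i := by
  simp only [PrePolygon.edgeSet, smulPoly, Set.image_image]

theorem smulPoly_carrier {k : ℕ} (g : G) (P : PrePolygon X k) :
    (smulPoly g P).carrier = (fun x => g • x) '' P.carrier := by
  simp only [PrePolygon.carrier, smulPoly_edgeSet, Set.image_iUnion]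

theorem smulPoly_opp {k : ℕ} (g : G) (P : PrePolygon X k) (i : Fin k) :
    (smulPoly g P).opp i = (fun x => g • x) '' P.opp i := by
  simp only [PrePolygon.opp, smulPoly_edgeSet, Set.image_iUnion]

theorem smulPoly_geodesic (hm : IsCayleyModel G S X x₀) {k : ℕ} (g : G) {P : PrePolygon X k}
    (h : P.IsGeodesicPolygon) : (smulPoly g P).IsGeodesicPolygon := by
  refine ⟨⟨h.1.1, fun i => ?_⟩, fun i => ⟨(h.2 i).1, fun s hs t ht => ?_⟩⟩
  · change g • P.edge i (P.len i) = g • _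
    rw [h.1.2 i]
  · change dist (g • _) (g • _) = _
    rw [hm.dist_smul]
    exact (h.2 i).2 s hs t ht

theorem smulPoly_fat (hm : IsCayleyModel G S X x₀) {k : ℕ} (g : G) {P : PrePolygon X k}
    {θ ν : ℝ} (h : P.IsFat2 θ ν) : (smulPoly g P).IsFat2 θ ν := by
  have hi := hm.2.2.2.1 g
  refine ⟨fun i p hp h1 h2 => ?_, fun i => ?_⟩
  · rw [smulPoly_edgeSet] at hp
    obtain ⟨p, hp, rfl⟩ := hp
    rw [smulPoly_edgeSet, smulPoly_carrier, ← Set.image_diff hi.injective, Metric.infDist_image hi]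
    refine h.1 i p hp ?_ ?_
    · change 2 * θ ≤ dist (g • p) (g • _) at h1
      rwa [hm.dist_smul] at h1
    · change 2 * θ ≤ dist (g • p) (g • _) at h2
      rwa [hm.dist_smul] at h2
  · rw [smulPoly_opp]
    change _ ≤ Metric.infDist (g • P.vertex i) _
    have := Metric.infDist_image (x := P.vertex i) (t := P.opp i) hi
    rw [this]
    exact h.2 i

theorem fat_good (hm : IsCayleyModel G S X x₀) (hε : 0 < ε) (hβ : Beta2With 𝓑 ε M)
    (hα : Alpha3 𝓑) (T : ℕ) (k : ℕ) (hk : 2 ≤ k) :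
    ∃ θ : ℝ, 0 < θ ∧ ∃ ν : ℝ, 8 ≤ ν ∧ ∃ χ : ℝ, 0 < χ ∧ ∃ Λ : ℝ,
      ∀ P : PrePolygon X k, P.IsGeodesicPolygon → P.IsFat2 θ ν →
        ∃ f : G → Set X, P.carrier ⊆ Bset χ f ∧
          ((∃ p ∈ P.carrier, ∃ q ∈ P.carrier, Λ ≤ dist p q) → Good S x₀ 𝓑 M T f) := by
  obtain ⟨θ, hθ, ν, hν, χ, hχ, H⟩ := hα k hk
  obtain ⟨Λ, hΛ⟩ := good_of_far hm hε hβ χ T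
  refine ⟨θ, hθ, ν, hν, χ, hχ, Λ, fun P hP hF => ?_⟩
  have H' : ∀ g : G, ∃ A ∈ 𝓑, (fun x => g • x) '' P.carrier ⊆ tubN χ A := by
    intro g
    have := H (smulPoly g P) (smulPoly_geodesic hm g hP) (smulPoly_fat hm g hF)
    rwa [smulPoly_carrier] at this
  choose f hf hfs using H'
  have hsub : P.carrier ⊆ Bset χ f := fun x hx g => hfs g ⟨x, hx, rfl⟩
  exact ⟨f, hsub, fun ⟨p, hp, q, hq, hpq⟩ => hΛ f hf p (hsub hp) q (hsub hq) hpq⟩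

theorem hyperbolic_of_no_good (hm : IsCayleyModel G S X x₀) (hε : 0 < ε)
    (hβ : Beta2With 𝓑 ε M) (hα : Alpha3 𝓑) (T : ℕ)
    (hno : ∀ f : G → Set X, ¬ Good S x₀ 𝓑 M T f) : GromovHyperbolic X := by
  have key : ∀ k : ℕ, 2 ≤ k → ∃ θ : ℝ, 0 < θ ∧ ∃ ν : ℝ, 8 ≤ ν ∧ ∃ Λ : ℝ,
      BoundedFat X k θ ν Λ := by
    intro k hk
    obtain ⟨θ, hθ, ν, hν, χ, hχ, Λ, H⟩ := fat_good hm hε hβ hα T k hk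
    refine ⟨θ, hθ, ν, hν, Λ, fun P hP hF p hp q hq => ?_⟩
    obtain ⟨f, -, h⟩ := H P hP hF
    by_contra hcon
    exact hno f (h ⟨p, hp, q, hq, (not_le.1 hcon).le⟩)
  obtain ⟨θ, hθ, ν, hν, Λ, h4⟩ := key 4 (by norm_num)
  obtain ⟨θ', hθ', ν', hν', Λ', h6⟩ := key 6 (by norm_num)
  exact hyperbolic_of_boundedFat hm.2.2.1 hθ hν h4 hθ' hν' h6

end Fat

/-! ### Representatives and stabilizers -/

section Reps

variable {G : Type*} [Group G] {S : Set G} [MulAction G X] {x₀ : X}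
variable {𝓑 : Set (Set X)} {ε M : ℝ}

theorem exists_reps {F : Set (G → Set X)} (hF : F.Finite) :
    ∃ (m : ℕ) (φ : Fin m → G → Set X), (∀ i, φ i ∈ F) ∧
      (∀ i j a, ptrans a (φ i) = φ j → i = j) ∧
      ∀ f ∈ F, ∃ i a, f = ptrans a (φ i) := by
  let s : Setoid F :=
    { r := fun f f' => ∃ a : G, (f' : G → Set X) = ptrans a f
      iseqv := ⟨fun f => ⟨1, (ptrans_one _).symm⟩,
        fun {f f'} ⟨a, h⟩ => ⟨a⁻¹, by rw [h, ptrans_mul, inv_mul_cancel, ptrans_one]⟩,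
        fun {f f' f''} ⟨a, h⟩ ⟨b, h'⟩ => ⟨b * a, by rw [h', h, ptrans_mul]⟩⟩ }
  have : Finite F := hF
  obtain ⟨m, ⟨e⟩⟩ := Finite.exists_equiv_fin (Quotient s)
  refine ⟨m, fun i => ((e.symm i).out : F), fun i => ((e.symm i).out : F).2, ?_, ?_⟩
  · intro i j a h
    have : (e.symm i).out ≈ (e.symm j).out := ⟨a, h.symm⟩
    have h2 := Quotient.sound this
    rw [Quotient.out_eq, Quotient.out_eq] at h2
    exact e.symm.injective h2
  · intro f hf
    refine ⟨e ⟦⟨f, hf⟩⟧, ?_⟩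
    obtain ⟨a, h⟩ := Quotient.mk_out (s := s) ⟨f, hf⟩
    refine ⟨a, ?_⟩
    simpa using h

/-- The stabilizer of a prescription. -/
def pstab (f : G → Set X) : Subgroup G where
  carrier := {a | ptrans a f = f}
  one_mem' := ptrans_one f
  mul_mem' := by
    intro a b ha hb
    change ptrans (a * b) f = f
    change ptrans a f = f at ha
    change ptrans b f = f at hb
    rw [← ptrans_mul, hb, ha]
  inv_mem' := by
    intro a ha
    change ptrans a⁻¹ f = f
    change ptrans a f = f at ha
    conv_lhs => rw [← ha]
    rw [ptrans_mul, inv_mul_cancel, ptrans_one]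

theorem mem_pstab {f : G → Set X} {a : G} : a ∈ pstab f ↔ ptrans a f = f := Iff.rfl

theorem exists_bounded_trans (S : Set G) {F : Set (G → Set X)} (hF : F.Finite) :
    ∃ R : ℕ, ∀ f ∈ F, ∀ f' ∈ F, (∃ g : G, ptrans g f = f') →
      ∃ g : G, wordNorm S g ≤ R ∧ ptrans g f = f' := by
  have ex : ∀ p : (G → Set X) × (G → Set X), ∃ g : G, (∃ g : G, ptrans g p.1 = p.2) →
      ptrans g p.1 = p.2 := by
    intro p
    by_cases h : ∃ g : G, ptrans g p.1 = p.2
    · exact ⟨h.choose, fun _ => h.choose_spec⟩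
    · exact ⟨1, fun h' => absurd h' h⟩
  choose u hu using ex
  obtain ⟨R, hR⟩ := ((hF.prod hF).image (fun p => wordNorm S (u p))).bddAbove
  refine ⟨R, fun f hf f' hf' h => ⟨u (f, f'), hR ⟨(f, f'), ⟨hf, hf'⟩, rfl⟩, hu (f, f') h⟩⟩

/-- Points of the orbit in `B_φ^M` are close to the stabilizer of `φ`. -/
theorem near_pstab (hm : IsCayleyModel G S X x₀) {T R : ℕ}
    (hR : ∀ f, Good S x₀ 𝓑 M T f ∧ x₀ ∈ Bset M f → ∀ f', Good S x₀ 𝓑 M T f' ∧ x₀ ∈ Bset M f' →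
      (∃ g : G, ptrans g f = f') → ∃ g : G, wordNorm S g ≤ R ∧ ptrans g f = f')
    {φ : G → Set X} (hφ : Good S x₀ 𝓑 M T φ ∧ x₀ ∈ Bset M φ) {g : G} (hg : g • x₀ ∈ Bset M φ) :
    ∃ h ∈ pstab φ, wordNorm S (g⁻¹ * h) ≤ R := by
  have hg' := (smul_mem_Bset g).1 hg
  obtain ⟨u, hu, hu'⟩ := hR φ hφ (ptrans g⁻¹ φ) ⟨hφ.1.ptrans g⁻¹, hg'⟩ ⟨g⁻¹, rfl⟩
  refine ⟨g * u, ?_, by simpa using hu⟩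
  rw [mem_pstab, ← ptrans_mul, hu', ptrans_mul, mul_inv_cancel, ptrans_one]

theorem pstab_subset {φ : G → Set X} (h0 : x₀ ∈ Bset M φ) {h : G} (hh : h ∈ pstab φ) :
    h • x₀ ∈ Bset M φ := by
  rw [smul_mem_Bset, mem_pstab.1 ((pstab φ).inv_mem hh)]
  exact h0

theorem pstab_fg (hm : IsCayleyModel G S X x₀) (hε : 0 < ε) (hβ : Beta2With 𝓑 ε M) {R : ℕ}
    {φ : G → Set X} (hv : ∀ g, φ g ∈ 𝓑) (h0 : x₀ ∈ Bset M φ)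
    (hn : ∀ g : G, g • x₀ ∈ Bset M φ → ∃ h ∈ pstab φ, wordNorm S (g⁻¹ * h) ≤ R) :
    (pstab φ).FG := by
  obtain ⟨N, hN⟩ := exists_nat_ge (M / ε)
  have hfin : {h : G | h ∈ pstab φ ∧ wordNorm S h ≤ N + 3 * R + 10}.Finite :=
    (finite_ball hm.1 hm.2.1 (N + 3 * R + 10)).subset fun h hh => hh.2
  refine (Subgroup.fg_iff _).2 ⟨_, le_antisymm ?_ ?_, hfin⟩
  · rw [Subgroup.closure_le]
    exact fun h hh => hh.1
  · suffices H : ∀ n : ℕ, ∀ h ∈ pstab φ, wordNorm S h = n →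
        h ∈ Subgroup.closure {h : G | h ∈ pstab φ ∧ wordNorm S h ≤ N + 3 * R + 10} from
      fun h hh => H _ h hh rfl
    intro n
    induction n using Nat.strong_induction_on with
    | _ n ih =>
      intro h hh hhn
      by_cases hle : n ≤ N + 3 * R + 10
      · exact Subgroup.subset_closure ⟨hh, by omega⟩
      · have hnN : (N : ℝ) ≤ n := by exact_mod_cast (by omega : N ≤ n)
        have hK : M ≤ ε * n := by
          rw [div_le_iff₀ hε] at hN
          nlinarith
        obtain ⟨c, hc, hc1, hc2⟩ := orbit_mid hm hβ hv (a := 1) (b := h) (by rwa [one_smul])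
          (pstab_subset h0 hh) (by simpa using hhn) hK (i := (n + 2) / 3) (by omega) (by omega)
        obtain ⟨h', hh', hr⟩ := hn c hc
        have t1 := dist_triangle x₀ (c • x₀) (h' • x₀)
        rw [hm.dist_one, hm.dist_one, hm.dist_eq] at t1
        have t1' : wordNorm S h' ≤ wordNorm S c + wordNorm S (c⁻¹ * h') := by exact_mod_cast t1
        have t2 := dist_triangle (h' • x₀) (c • x₀) (h • x₀)
        rw [dist_comm (h' • x₀) (c • x₀), hm.dist_eq, hm.dist_eq, hm.dist_eq] at t2
        have t2' : wordNorm S (h'⁻¹ * h) ≤ wordNorm S (c⁻¹ * h') + wordNorm S (c⁻¹ * h) := by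
          exact_mod_cast t2
        rw [inv_one, one_mul] at hc1
        have m1 := ih _ (by omega) h' hh' rfl
        have m2 := ih _ (by omega) (h'⁻¹ * h) ((pstab φ).mul_mem ((pstab φ).inv_mem hh') hh) rfl
        have := Subgroup.mul_mem _ m1 m2
        rwa [mul_inv_cancel_left] at this

/-- Points of `B^K` are close to the corresponding coset. -/
theorem close_coset (hm : IsCayleyModel G S X x₀) (hε : 0 < ε) (hβ : Beta2With 𝓑 ε M) {R : ℕ}
    (K : ℝ) :
    ∃ N : ℝ, 0 < N ∧ ∀ φ : G → Set X, (∀ g, φ g ∈ 𝓑) → x₀ ∈ Bset M φ →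
      (∀ g : G, g • x₀ ∈ Bset M φ → ∃ h ∈ pstab φ, wordNorm S (g⁻¹ * h) ≤ R) →
      ∀ a : G, ∀ x ∈ Bset K (ptrans a φ),
        x ∈ tubN N (orbitMap x₀ '' ((a * ·) '' (pstab φ : Set G))) := by
  obtain ⟨N, hN⟩ := orbit_near (x₀ := x₀) (S := S) (K := max M (K + 1 / 2)) hm hε hβ
    (le_max_left _ _)
  refine ⟨N + R + 1, by positivity, fun φ hv h0 hn a x hx => ?_⟩
  obtain ⟨b, hb⟩ := hm.2.2.2.2.2 x
  have h1 := Bset_mono (le_max_right M _) _ (mem_Bset_of_dist hm hx hb)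
  have h2 : (a⁻¹ * b) • x₀ ∈ Bset (max M (K + 1 / 2)) φ := by
    rw [mul_smul, smul_mem_Bset, inv_inv]; exact h1
  obtain ⟨r, hr, hr'⟩ := hN φ hv 1 (by rwa [one_smul]) _ h2
  obtain ⟨h, hh, hhr⟩ := hn r hr
  have hmem : (a * h) • x₀ ∈ orbitMap x₀ '' ((a * ·) '' (pstab φ : Set G)) :=
    ⟨a * h, ⟨h, hh, rfl⟩, rfl⟩
  refine lt_of_le_of_lt (Metric.infDist_le_dist_of_mem hmem) ?_
  have t := dist_triangle4 x (b • x₀) ((a * r) • x₀) ((a * h) • x₀)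
  rw [hm.dist_eq, hm.dist_eq, show b⁻¹ * (a * r) = (a⁻¹ * b)⁻¹ * r by group,
    show (a * r)⁻¹ * (a * h) = r⁻¹ * h by group] at t
  have e1 : (wordNorm S ((a⁻¹ * b)⁻¹ * r) : ℝ) ≤ N := by exact_mod_cast hr'
  have e2 : (wordNorm S (r⁻¹ * h) : ℝ) ≤ R := by exact_mod_cast hhr
  linarith

/-- Points close to a coset lie in `B^{M+δ}`. -/
theorem coset_close (hm : IsCayleyModel G S X x₀) {φ : G → Set X} (h0 : x₀ ∈ Bset M φ) {δ : ℝ}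
    {a : G} {x : X} (hx : x ∈ tubN δ (orbitMap x₀ '' ((a * ·) '' (pstab φ : Set G)))) :
    x ∈ Bset (M + δ) (ptrans a φ) := by
  have hne : (orbitMap x₀ '' ((a * ·) '' (pstab φ : Set G))).Nonempty :=
    ⟨_, a * 1, ⟨1, (pstab φ).one_mem, rfl⟩, rfl⟩
  obtain ⟨_, ⟨_, ⟨h, hh, rfl⟩, rfl⟩, hd⟩ := (Metric.infDist_lt_iff hne).1 hx
  refine mem_Bset_of_dist hm (x := (a * h) • x₀) ?_ (by rw [dist_comm]; exact hd.le)
  rw [mul_smul, smul_mem_Bset, ptrans_mul, inv_mul_cancel, ptrans_one]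
  exact pstab_subset h0 hh

theorem atg_cosets (hm : IsCayleyModel G S X x₀) (hε : 0 < ε) (hM : 0 ≤ M)
    (hβ : Beta2With 𝓑 ε M) (hα1 : Alpha1 𝓑) (hα3 : Alpha3 𝓑) {T R m : ℕ} (hmpos : 0 < m)
    (φ : Fin m → G → Set X) (hφ : ∀ i, Good S x₀ 𝓑 M T (φ i) ∧ x₀ ∈ Bset M (φ i))
    (hinj : ∀ i j a, ptrans a (φ i) = φ j → i = j)
    (hsurj : ∀ f, Good S x₀ 𝓑 M T f → ∃ i a, f = ptrans a (φ i))
    (hn : ∀ i, ∀ g : G, g • x₀ ∈ Bset M (φ i) →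
      ∃ h ∈ pstab (φ i), wordNorm S (g⁻¹ * h) ≤ R) :
    ATG (cosetFam x₀ fun i => pstab (φ i)) := by
  refine ⟨?_, ?_, ?_⟩
  · intro δ hδ
    obtain ⟨D, hD⟩ := Bset_alpha1 hm hα1 (K := M + δ) (by linarith)
    refine ⟨D, ?_⟩
    rintro _ ⟨i, a, rfl⟩ _ ⟨j, b, rfl⟩ hne x ⟨hx, hx'⟩ y ⟨hy, hy'⟩
    refine hD (ptrans a (φ i)) (ptrans b (φ j)) (fun g => (hφ i).1.1 _) (fun g => (hφ j).1.1 _) ?_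
      x y (coset_close hm (hφ i).2 hx) (coset_close hm (hφ j).2 hx')
      (coset_close hm (hφ i).2 hy) (coset_close hm (hφ j).2 hy')
    intro heq
    apply hne
    have h1 : ptrans (b⁻¹ * a) (φ i) = φ j := by
      rw [← ptrans_mul, heq, ptrans_mul, inv_mul_cancel, ptrans_one]
    obtain rfl := hinj _ _ _ h1
    have h2 : b⁻¹ * a ∈ pstab (φ i) := h1
    congr 1
    ext z
    constructor
    · rintro ⟨h, hh, rfl⟩
      exact ⟨b⁻¹ * a * h, (pstab (φ i)).mul_mem h2 hh, by change b * (b⁻¹ * a * h) = a * h; group⟩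
    · rintro ⟨h, hh, rfl⟩
      exact ⟨(b⁻¹ * a)⁻¹ * h, (pstab (φ i)).mul_mem ((pstab (φ i)).inv_mem h2) hh, by
        change a * ((b⁻¹ * a)⁻¹ * h) = b * h; group⟩
  · obtain ⟨N, hN0, hN⟩ := close_coset (R := R) hm hε hβ M
    have hq : 0 ≤ 2 * M / ε := by positivity
    refine ⟨min (ε / 2) (1 / 4), N + 2 * M / ε + 1, by positivity,
      lt_of_le_of_lt (min_le_right _ _) (by norm_num), by linarith, ?_⟩
    rintro γ ℓ hγ _ ⟨i, a, rfl⟩ h0 h1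
    have hℓ := hγ.1
    have l1 : min (ε / 2) (1 / 4) * ℓ ≤ ε / 2 * ℓ :=
      mul_le_mul_of_nonneg_right (min_le_left _ _) hℓ
    have l2 : min (ε / 2) (1 / 4) * ℓ ≤ 1 / 4 * ℓ :=
      mul_le_mul_of_nonneg_right (min_le_right _ _) hℓ
    by_cases hc : M ≤ ε / 2 * ℓ
    · refine ⟨ℓ / 2, ⟨by linarith, by linarith⟩, tubN_mono (by linarith) _
        (hN (φ i) (hφ i).1.1 (hφ i).2 (hn i) a _ ?_)⟩
      exact Bset_mid hm hβ (fun g => (hφ i).1.1 _) hγ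
        (K := M + min (ε / 2) (1 / 4) * ℓ) (by linarith)
        (coset_close hm (hφ i).2 h0) (coset_close hm (hφ i).2 h1) ⟨by linarith, by linarith⟩
    · refine ⟨0, ⟨le_rfl, hℓ⟩, tubN_mono ?_ _ h0⟩
      have : ℓ ≤ 2 * M / ε := by
        rw [le_div_iff₀ hε]; linarith
      linarith
  · intro k hk
    obtain ⟨θ, hθ, ν, hν, χ, hχ, Λ, H⟩ := fat_good hm hε hβ hα3 T k hk
    obtain ⟨N, hN0, hN⟩ := close_coset (R := R) hm hε hβ χ
    refine ⟨θ, hθ, ν, hν, N + |Λ| + 1, by positivity, fun P hP hF => ?_⟩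
    have hΛ := le_abs_self Λ
    have hΛ' := abs_nonneg Λ
    obtain ⟨f, hf, hfg⟩ := H P hP hF
    by_cases hc : ∃ p ∈ P.carrier, ∃ q ∈ P.carrier, Λ ≤ dist p q
    · obtain ⟨i, a, rfl⟩ := hsurj f (hfg hc)
      refine ⟨_, ⟨i, a, rfl⟩, fun x hx => tubN_mono (by linarith) _
        (hN (φ i) (hφ i).1.1 (hφ i).2 (hn i) a x (hf hx))⟩
    · push Not at hc
      let i₀ : Fin k := ⟨0, by omega⟩
      have hp : P.edge i₀ 0 ∈ P.carrier :=
        Set.mem_iUnion.2 ⟨i₀, 0, ⟨le_rfl, hP.1.1 i₀⟩, rfl⟩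
      obtain ⟨g, hg⟩ := hm.2.2.2.2.2 (P.edge i₀ 0)
      refine ⟨_, ⟨⟨0, hmpos⟩, g, rfl⟩, fun x hx => ?_⟩
      have hmem : g • x₀ ∈ orbitMap x₀ '' ((g * ·) '' (pstab (φ ⟨0, hmpos⟩) : Set G)) :=
        ⟨g * 1, ⟨1, (pstab _).one_mem, rfl⟩, by simp [orbitMap]⟩
      refine lt_of_le_of_lt (Metric.infDist_le_dist_of_mem hmem) ?_
      have t := dist_triangle x (P.edge i₀ 0) (g • x₀)
      have := hc x hx _ hp
      linarith

end Reps
/-- **Theorem.** Let `G` be an infinite finitely generated group with word metric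
(modelled by a Cayley graph `X` with basepoint `x₀`), asymptotically tree-graded with
respect to a collection `𝓐` of subsets of `G`, with `G` not contained in any
finite-radius tubular neighborhood of a member of `𝓐`.  Let `ϰ = max M χ` where `M`
is the constant of (β₂) and `χ` the constant of (β₃).  Then `G` is either hyperbolic,
or hyperbolic relative to a family of proper finitely generated subgroups
`H₁, …, H_m` such that each `H i` is contained in `N_ϰ(A)` for some `A ∈ 𝓐`. -/
theorem relhyp_of_atg {G : Type*} [Group G] (S : Set G)
    {X : Type*} [MetricSpace X] [MulAction G X] (x₀ : X)
    (hmodel : IsCayleyModel G S X x₀) (hinf : Infinite G)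
    (𝓐 : Set (Set G))
    (hATG : ATG (imageFam x₀ 𝓐))
    (hproper : ∀ A ∈ 𝓐, ∀ r : ℝ,
      ¬ (Set.range (orbitMap (G := G) x₀) ⊆ tubN r (orbitMap x₀ '' A)))
    (ε M : ℝ) (hε : 0 < ε) (hM : 0 ≤ M) (hβ2 : Beta2With (imageFam x₀ 𝓐) ε M)
    (θ ν χ : ℝ) (hθ : 0 < θ) (hν : 8 ≤ ν) (hχ : 0 < χ)
    (hβ3 : Beta3With (imageFam x₀ 𝓐) θ ν χ) :
    GromovHyperbolic X ∨
      ∃ (m : ℕ) (H : Fin m → Subgroup G),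
        (∀ i, H i ≠ ⊤) ∧ (∀ i, (H i).FG) ∧ ATG (cosetFam x₀ H) ∧
        ∀ i, ∃ A ∈ 𝓐,
          orbitMap x₀ '' (H i : Set G) ⊆ tubN (max M χ) (orbitMap x₀ '' A) := by
  obtain ⟨hα1, -, hα3⟩ := hATG
  obtain ⟨D, hD⟩ := Bset_alpha1 hmodel hα1 (K := M + 1) (by linarith)
  obtain ⟨T, hT⟩ := exists_nat_gt D
  by_cases hno : ∀ f : G → Set X, ¬ Good S x₀ (imageFam x₀ 𝓐) M T f
  · exact Or.inl (hyperbolic_of_no_good hmodel hε hβ2 hα3 T hno)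
  push Not at hno
  obtain ⟨f₀, hf₀⟩ := hno
  have hfin := finite_good hmodel hε hβ2 (by linarith : M ≤ M + 1) hD hT
  obtain ⟨m, φ, hφ, hinj, hrep⟩ := exists_reps hfin
  obtain ⟨R, hR⟩ := exists_bounded_trans S hfin
  have hsurj : ∀ f, Good S x₀ (imageFam x₀ 𝓐) M T f → ∃ i a, f = ptrans a (φ i) := by
    intro f hf
    obtain ⟨a, b, ha, -⟩ := hf.2
    obtain ⟨i, c, hc⟩ := hrep (ptrans a⁻¹ f) ⟨hf.ptrans a⁻¹, (smul_mem_Bset a).1 ha⟩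
    refine ⟨i, a * c, ?_⟩
    rw [← ptrans_mul, ← hc, ptrans_mul, mul_inv_cancel, ptrans_one]
  have hn : ∀ i, ∀ g : G, g • x₀ ∈ Bset M (φ i) →
      ∃ h ∈ pstab (φ i), wordNorm S (g⁻¹ * h) ≤ R := fun i g hg =>
    near_pstab hmodel hR (hφ i) hg
  have hcont : ∀ i, ∃ A ∈ 𝓐,
      orbitMap x₀ '' (pstab (φ i) : Set G) ⊆ tubN (max M χ) (orbitMap x₀ '' A) := by
    intro i
    obtain ⟨A, hA, hAe⟩ := (hφ i).1.1 1
    refine ⟨A, hA, ?_⟩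
    rintro _ ⟨h, hh, rfl⟩
    have := pstab_subset (hφ i).2 hh 1
    rw [hAe, one_smul] at this
    exact tubN_mono (le_max_left _ _) _ this
  have hmpos : 0 < m := by
    obtain ⟨i, -⟩ := hsurj f₀ hf₀
    exact i.pos
  refine Or.inr ⟨m, fun i => pstab (φ i), ?_, ?_, ?_, hcont⟩
  · intro i htop
    obtain ⟨A, hA, hsub⟩ := hcont i
    change pstab (φ i) = ⊤ at htop
    rw [htop, Subgroup.coe_top, Set.image_univ] at hsub
    exact hproper A hA _ hsub
  · intro i
    exact pstab_fg hmodel hε hβ2 (hφ i).1.1 (hφ i).2 (hn i)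
  · exact atg_cosets hmodel hε hM hβ2 hα1 hα3 hmpos φ hφ hinj hsurj hn
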